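/- Let G be any maximal virtually cyclic subgroup of B₄(S²). Then at least one of the following holds: (i) G is isomorphic to SL(2, ZMod 3) (the binary tetrahedral group T*); (ii) there exists a homomorphism φ : Multiplicative ℤ →* MulAut (QuaternionGroup 2) such that G is isomorphic to the semidirect product (QuaternionGroup 2) ⋊_φ Multiplicative ℤ; (iii) there exist injective homomorphisms j₁, j₂ : QuaternionGroup 2 →* QuaternionGroup 4 such that G is isomorphic to the amalgamated free product (pushout) of j₁ and j₂, i.e. to Q₁₆ *_{Q₈} Q₁₆. -/

import Mathlib

/-- The defining relators of the sphere braid group `B₄(S²)` on generators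
`σ₁ = of 0`, `σ₂ = of 1`, `σ₃ = of 2`:
`σ₁σ₃ = σ₃σ₁`, `σ₁σ₂σ₁ = σ₂σ₁σ₂`, `σ₂σ₃σ₂ = σ₃σ₂σ₃`, `σ₁σ₂σ₃²σ₂σ₁ = 1`. -/
def sphereBraidRels : Set (FreeGroup (Fin 3)) :=
  { FreeGroup.of 0 * FreeGroup.of 2 * (FreeGroup.of 2 * FreeGroup.of 0)⁻¹,
    FreeGroup.of 0 * FreeGroup.of 1 * FreeGroup.of 0 *
      (FreeGroup.of 1 * FreeGroup.of 0 * FreeGroup.of 1)⁻¹,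
    FreeGroup.of 1 * FreeGroup.of 2 * FreeGroup.of 1 *
      (FreeGroup.of 2 * FreeGroup.of 1 * FreeGroup.of 2)⁻¹,
    FreeGroup.of 0 * FreeGroup.of 1 * FreeGroup.of 2 ^ 2 * FreeGroup.of 1 * FreeGroup.of 0 }

/-- The braid group `B₄(S²)` of the sphere on four strings, as a presented group. -/
abbrev B4S2 : Type := PresentedGroup sphereBraidRels

/-- The generator `σᵢ₊₁` of `B₄(S²)`. -/
def σ (i : Fin 3) : B4S2 := PresentedGroup.of i

/-- A group is *virtually cyclic* if it contains a cyclic subgroup of finite index. -/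
def IsVirtuallyCyclic (G : Type*) [Group G] : Prop :=
  ∃ H : Subgroup G, IsCyclic H ∧ H.FiniteIndex

/-- A subgroup `H` of `G` is *maximal as a virtually cyclic subgroup* if `H` is virtually
cyclic and is not properly contained in any virtually cyclic subgroup of `G`. -/
def IsMaximalVirtuallyCyclic {G : Type*} [Group G] (H : Subgroup G) : Prop :=
  IsVirtuallyCyclic H ∧ ∀ K : Subgroup G, IsVirtuallyCyclic K → H ≤ K → K = H

section VirtuallyCyclic

variable {G G' : Type*} [Group G] [Group G']

theorem isVirtuallyCyclic_of_cover {z : G} {S : Set G} (hS : S.Finite)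
    (h : ∀ g : G, ∃ s ∈ S, ∃ k : ℤ, g = s * z ^ k) : IsVirtuallyCyclic G := by
  refine ⟨Subgroup.zpowers z, inferInstance, ?_⟩
  have : Finite (G ⧸ Subgroup.zpowers z) := by
    have := hS.to_subtype
    refine Finite.of_surjective (fun s : S => (QuotientGroup.mk (s : G) : G ⧸ Subgroup.zpowers z))
      fun q => ?_
    obtain ⟨g, rfl⟩ := QuotientGroup.mk_surjective q
    obtain ⟨s, hs, k, rfl⟩ := h g
    exact ⟨⟨s, hs⟩, QuotientGroup.eq.2 (by simp)⟩
  exact Subgroup.finiteIndex_of_finite_quotient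

theorem IsVirtuallyCyclic.exists_cover (h : IsVirtuallyCyclic G) :
    ∃ (z : G) (S : Set G), S.Finite ∧ ∀ g : G, ∃ s ∈ S, ∃ k : ℤ, g = s * z ^ k := by
  obtain ⟨H, hc, hf⟩ := h
  obtain ⟨z, rfl⟩ := (Subgroup.isCyclic_iff_exists_zpowers_eq_top H).1 hc
  have := Subgroup.finite_quotient_of_finiteIndex (H := Subgroup.zpowers z)
  refine ⟨z, Set.range (Quotient.out : G ⧸ Subgroup.zpowers z → G), Set.finite_range _,
    fun g => ⟨_, ⟨(g : G ⧸ Subgroup.zpowers z), rfl⟩, ?_⟩⟩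
  obtain ⟨k, hk⟩ := QuotientGroup.eq.1 (QuotientGroup.out_eq' (g : G ⧸ Subgroup.zpowers z))
  exact ⟨k, by simp only at hk; rw [hk]; group⟩

theorem IsVirtuallyCyclic.of_surjective (h : IsVirtuallyCyclic G) (f : G →* G')
    (hf : Function.Surjective f) : IsVirtuallyCyclic G' := by
  obtain ⟨z, S, hS, hz⟩ := h.exists_cover
  refine isVirtuallyCyclic_of_cover (z := f z) (hS.image f) fun g => ?_
  obtain ⟨g, rfl⟩ := hf g
  obtain ⟨s, hs, k, rfl⟩ := hz g
  exact ⟨f s, ⟨s, hs, rfl⟩, k, by simp⟩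

theorem IsVirtuallyCyclic.of_finite_ker (f : G →* G') (hf : Function.Surjective f)
    (hk : (f.ker : Set G).Finite) (h : IsVirtuallyCyclic G') : IsVirtuallyCyclic G := by
  obtain ⟨z, S, hS, hz⟩ := h.exists_cover
  obtain ⟨z, rfl⟩ := hf z
  refine isVirtuallyCyclic_of_cover (z := z)
    ((hS.image (Function.surjInv hf)).mul hk) fun g => ?_
  obtain ⟨s, hs, k, h⟩ := hz (f g)
  refine ⟨g * z ^ (-k), Set.mem_mul.2 ⟨Function.surjInv hf s, ⟨s, hs, rfl⟩,
    (Function.surjInv hf s)⁻¹ * (g * z ^ (-k)), ?_, by group⟩, k, by group⟩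
  simp [MonoidHom.mem_ker, Function.surjInv_eq, h]

theorem zpow_injective_of_not_isOfFinOrder {c : G} (hc : ¬IsOfFinOrder c) :
    Function.Injective fun n : ℤ => c ^ n :=
  injective_zpow_iff_not_isOfFinOrder.2 hc

theorem exists_zpow_mul_of_sq_eq_one {x y : G} (hx : x ^ 2 = 1) (hy : y ^ 2 = 1)
    (hG : Subgroup.closure {x, y} = ⊤) (g : G) :
    ∃ k : ℤ, g = (x * y) ^ k ∨ g = x * (x * y) ^ k := by
  have hxi : x⁻¹ = x := inv_eq_of_mul_eq_one_right (by rwa [← pow_two])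
  have hyi : y⁻¹ = y := inv_eq_of_mul_eq_one_right (by rwa [← pow_two])
  have hxx : ∀ w, x * (x * w) = w := fun w => by rw [← mul_assoc, ← pow_two, hx, one_mul]
  have hyy : ∀ w, y * (y * w) = w := fun w => by rw [← mul_assoc, ← pow_two, hy, one_mul]
  have hg : g ∈ Subgroup.closure {x, y} := hG ▸ Subgroup.mem_top g
  have hl : ∀ w, (∃ k : ℤ, w = (x * y) ^ k ∨ w = x * (x * y) ^ k) →
      ∃ k : ℤ, x * w = (x * y) ^ k ∨ x * w = x * (x * y) ^ k := by
    rintro w ⟨k, rfl | rfl⟩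
    · exact ⟨k, .inr rfl⟩
    · exact ⟨k, .inl (hxx _)⟩
  have hr : ∀ w, (∃ k : ℤ, w = (x * y) ^ k ∨ w = x * (x * y) ^ k) →
      ∃ k : ℤ, (x * y) * w = (x * y) ^ k ∨ (x * y) * w = x * (x * y) ^ k := by
    rintro w ⟨k, rfl | rfl⟩
    · exact ⟨1 + k, .inl (by rw [zpow_add, zpow_one])⟩
    · refine ⟨-1 + k, .inr ?_⟩
      rw [zpow_add, zpow_neg_one, mul_inv_rev, hxi, hyi]
      simp only [mul_assoc]
  have hly : ∀ w, (∃ k : ℤ, w = (x * y) ^ k ∨ w = x * (x * y) ^ k) →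
      ∃ k : ℤ, y * w = (x * y) ^ k ∨ y * w = x * (x * y) ^ k := fun w hw => by
    have := hl _ (hr _ hw)
    rwa [mul_assoc, hxx] at this
  induction hg using Subgroup.closure_induction_left with
  | one => exact ⟨0, by simp⟩
  | mul_left a ha w _ ih =>
    rcases ha with rfl | rfl
    exacts [hl _ ih, hly _ ih]
  | inv_mul_cancel a ha w _ ih =>
    rcases ha with rfl | rfl
    · rw [hxi]; exact hl _ ih
    · rw [hyi]; exact hly _ ih

theorem isVirtuallyCyclic_of_sq_eq_one {x y : G} (hx : x ^ 2 = 1) (hy : y ^ 2 = 1)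
    (hG : Subgroup.closure {x, y} = ⊤) : IsVirtuallyCyclic G := by
  refine isVirtuallyCyclic_of_cover (z := x * y) (S := {1, x}) (by simp) fun g => ?_
  obtain ⟨k, h | h⟩ := exists_zpow_mul_of_sq_eq_one hx hy hG g
  · exact ⟨1, by simp, k, by simpa using h⟩
  · exact ⟨x, by simp, k, h⟩

theorem zpowers_conj_eq_or {c x : G} (hc : ¬IsOfFinOrder c)
    (h : ∀ g : G, g * c * g⁻¹ ∈ Subgroup.zpowers c) :
    x * c * x⁻¹ = c ∨ x * c * x⁻¹ = c⁻¹ := by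
  obtain ⟨m, hm⟩ := h x
  obtain ⟨n, hn⟩ := h x⁻¹
  simp only [inv_inv] at hm hn
  have hmn : c ^ (m * n) = c ^ (1 : ℤ) := by
    rw [zpow_mul, hm, conj_zpow, hn]; group
  have hmn := zpow_injective_of_not_isOfFinOrder hc hmn
  rcases Int.eq_one_or_neg_one_of_mul_eq_one hmn with rfl | rfl
  · left; simpa using hm.symm
  · right; simpa using hm.symm

/-- The structure of infinite virtually cyclic groups in which the centralizers of nontrivial
torsion elements are torsion. -/
theorem IsVirtuallyCyclic.exists_zpowers [Infinite G] (hv : IsVirtuallyCyclic G)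
    (hG : ∀ x y : G, x ≠ 1 → IsOfFinOrder x → Commute x y → IsOfFinOrder y) :
    ∃ c : G, ¬IsOfFinOrder c ∧ ((∀ g, g ∈ Subgroup.zpowers c) ∨
      ∃ x, x ∉ Subgroup.zpowers c ∧ x ^ 2 = 1 ∧ x * c * x⁻¹ = c⁻¹ ∧
        ∀ g, g ∈ Subgroup.zpowers c ∨ g * x ∈ Subgroup.zpowers c) := by
  obtain ⟨Z, hZc, hZf⟩ := hv
  have hT : ∃ t : G, Subgroup.zpowers t = Z.normalCore := by
    refine (Subgroup.isCyclic_iff_exists_zpowers_eq_top _).1 ?_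
    exact isCyclic_of_injective (Subgroup.inclusion Z.normalCore_le)
      (Subgroup.inclusion_injective _)
  obtain ⟨t, ht⟩ := hT
  have hfin : (Subgroup.zpowers t).FiniteIndex := ht ▸ inferInstance
  have hnorm : (Subgroup.zpowers t).Normal := ht ▸ inferInstance
  have hto : ¬IsOfFinOrder t := fun h => by
    have : Finite (Subgroup.zpowers t) := h.finite_zpowers
    exact not_finite_iff_infinite.2 ‹Infinite G› 
      ((Subgroup.finite_iff_finite_and_finiteIndex _).2 ⟨this, hfin⟩)
  have hconj : ∀ g : G, g * t * g⁻¹ = t ∨ g * t * g⁻¹ = t⁻¹ := fun g =>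
    zpowers_conj_eq_or hto fun g => hnorm.conj_mem t (Subgroup.mem_zpowers t) g
  let C : Subgroup G := Subgroup.centralizer {t}
  have hC : ∀ g, g ∈ C ↔ g * t * g⁻¹ = t := fun g => by
    rw [Subgroup.mem_centralizer_singleton_iff, mul_inv_eq_iff_eq_mul]
  have htC : Subgroup.zpowers t ≤ C := by
    rw [Subgroup.zpowers_le, hC]; group
  have htf : ∀ g : C, IsOfFinOrder g → g = 1 := fun g hg => by
    by_contra hne
    refine hto (hG g t (by simpa using hne) ?_ ?_)
    · exact C.subtype.isOfFinOrder hg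
    · exact ((Subgroup.mem_centralizer_singleton_iff).1 g.2)
  have hZC : (Subgroup.zpowers t).subgroupOf C ≤ Subgroup.center C := by
    intro g hg
    rw [Subgroup.mem_center_iff]
    rintro ⟨h, hh⟩
    obtain ⟨k, hk⟩ := Subgroup.mem_subgroupOf.1 hg
    ext
    simp only at hk
    simp only [Subgroup.coe_mul, ← hk]
    have : Commute h t := (Subgroup.mem_centralizer_singleton_iff).1 hh
    exact this.zpow_right k
  have : (Subgroup.center C).FiniteIndex := Subgroup.finiteIndex_of_le hZC
  have hinj : Function.Injective (MonoidHom.transferCenterPow C) := by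
    refine (injective_iff_map_eq_one _).2 fun g hg => htf g ?_
    rw [isOfFinOrder_iff_pow_eq_one]
    exact ⟨_, Nat.pos_of_ne_zero Subgroup.FiniteIndex.index_ne_zero,
      by rw [← MonoidHom.transferCenterPow_apply, hg]; rfl⟩
  have hcomm : ∀ a b : C, a * b = b * a := fun a b => hinj (by
    rw [map_mul, map_mul]
    exact Subtype.ext ((Subgroup.mem_center_iff.1 (MonoidHom.transferCenterPow C a).2 _).symm))
  let _ : CommGroup C := { (inferInstance : Group C) with mul_comm := hcomm }
  have hcyc : IsCyclic C := by
    let n := ((Subgroup.zpowers t).subgroupOf C).index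
    have hn : 0 < n := Nat.pos_of_ne_zero Subgroup.FiniteIndex.index_ne_zero
    let p : C →* (Subgroup.zpowers t) :=
      { toFun := fun g => ⟨(g : G) ^ n, by
          have := Subgroup.pow_index_mem ((Subgroup.zpowers t).subgroupOf C) g
          simpa [Subgroup.mem_subgroupOf] using this⟩
        map_one' := by ext; simp
        map_mul' := fun a b => by
          ext
          have : Commute (a : G) b := congrArg Subtype.val (hcomm a b)
          simp [this.mul_pow] }
    refine isCyclic_of_injective p ((injective_iff_map_eq_one p).2 fun g hg => htf g ?_)
    rw [isOfFinOrder_iff_pow_eq_one]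
    exact ⟨n, hn, by ext; simpa [p] using congrArg Subtype.val hg⟩
  obtain ⟨c, hc⟩ := (Subgroup.isCyclic_iff_exists_zpowers_eq_top C).1 hcyc
  have hcC : c ∈ C := hc ▸ Subgroup.mem_zpowers c
  obtain ⟨m, hm⟩ : t ∈ Subgroup.zpowers c := hc ▸ htC (Subgroup.mem_zpowers t)
  simp only at hm
  have hco : ¬IsOfFinOrder c := fun h => hto (hm ▸ h.zpow)
  have hm0 : m ≠ 0 := by
    rintro rfl
    exact hto (by rw [← hm, zpow_zero]; exact IsOfFinOrder.one)
  refine ⟨c, hco, or_iff_not_imp_left.2 fun hne => ?_⟩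
  push Not at hne
  obtain ⟨x, hx⟩ := hne
  have hinv : ∀ g, g ∉ Subgroup.zpowers c → g * t * g⁻¹ = t⁻¹ := fun g hg =>
    (hconj g).resolve_left fun h => hg (hc ▸ (hC g).2 h)
  have hmulC : ∀ g h, g ∉ Subgroup.zpowers c → h ∉ Subgroup.zpowers c →
      g * h ∈ Subgroup.zpowers c := fun g h hg hh => by
    rw [hc, hC]
    have : g * h * t * (g * h)⁻¹ = g * (h * t * h⁻¹) * g⁻¹ := by group
    rw [this, hinv h hh, ← conj_inv, hinv g hg, inv_inv]
  have hcn : ∀ g, g * c * g⁻¹ ∈ Subgroup.zpowers c := fun g => by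
    rw [hc, hC]
    have h1 : g⁻¹ * t * g = g⁻¹ * t * g⁻¹⁻¹ := by group
    have h2 : c * (g⁻¹ * t * g) * c⁻¹ = g⁻¹ * t * g := by
      rcases hconj g⁻¹ with h | h
      · rw [h1, h]; exact (hC c).1 hcC
      · rw [h1, h, ← conj_inv, (hC c).1 hcC]
    have h3 : g * c * g⁻¹ * t * (g * c * g⁻¹)⁻¹ = g * (c * (g⁻¹ * t * g) * c⁻¹) * g⁻¹ := by group
    rw [h3, h2]; group
  have hxc : x * c * x⁻¹ = c⁻¹ := (zpowers_conj_eq_or hco hcn).resolve_left fun h => by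
    refine hx (hc ▸ (hC x).2 ?_)
    rw [← hm, ← conj_zpow, h]
  obtain ⟨k, hk⟩ := hmulC x x hx hx
  simp only at hk
  refine ⟨x, hx, ?_, hxc, fun g => or_iff_not_imp_left.2 fun hg => hmulC g x hg hx⟩
  have h1 : x * c ^ k * x⁻¹ = c ^ k := by rw [hk]; group
  rw [← conj_zpow, hxc, inv_zpow, ← zpow_neg] at h1
  have h2 := zpow_injective_of_not_isOfFinOrder hco h1
  have h3 : k = 0 := by omega
  rw [pow_two, ← hk, h3, zpow_zero]

end VirtuallyCyclic

section ModularGroup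

open Matrix

/-- The modular group `PSL(2, ℤ)`. -/
abbrev PSL2Z : Type := Matrix.ProjectiveSpecialLinearGroup (Fin 2) ℤ

namespace PSL2Z

/-- The projection `SL(2, ℤ) → PSL(2, ℤ)`. -/
abbrev mk : Matrix.SpecialLinearGroup (Fin 2) ℤ →* PSL2Z := QuotientGroup.mk' _

theorem mk_surjective : Function.Surjective mk := QuotientGroup.mk'_surjective _

theorem mk_eq_one {M : Matrix.SpecialLinearGroup (Fin 2) ℤ} : mk M = 1 ↔ M = 1 ∨ M = -1 := by
  rw [← MonoidHom.mem_ker, QuotientGroup.ker_mk', Matrix.SpecialLinearGroup.mem_center_iff]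
  constructor
  · rintro ⟨r, hr, h⟩
    rcases mul_self_eq_one_iff.1 (by simpa [pow_two] using hr) with rfl | rfl
    · left; ext i j; rw [← h]; simp [Matrix.one_apply]
    · right; ext i j; rw [← h]; fin_cases i <;> fin_cases j <;> simp
  · rintro (rfl | rfl)
    · exact ⟨1, by simp, by simp⟩
    · exact ⟨-1, by simp, by ext i j; fin_cases i <;> fin_cases j <;> simp⟩

theorem mk_eq_mk {M N : Matrix.SpecialLinearGroup (Fin 2) ℤ} : mk M = mk N ↔ M = N ∨ M = -N := by
  rw [← mul_inv_eq_one, ← map_inv, ← map_mul, mk_eq_one, mul_inv_eq_one, mul_inv_eq_iff_eq_mul,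
    neg_one_mul]

theorem det_eq_one (M : Matrix.SpecialLinearGroup (Fin 2) ℤ) :
    M 0 0 * M 1 1 - M 0 1 * M 1 0 = 1 := by
  rw [← Matrix.det_fin_two]; exact M.2

theorem sl_ext {M N : Matrix.SpecialLinearGroup (Fin 2) ℤ} (h1 : M 0 0 = N 0 0) (h2 : M 0 1 = N 0 1)
    (h3 : M 1 0 = N 1 0) (h4 : M 1 1 = N 1 1) : M = N := by
  ext i j; fin_cases i <;> fin_cases j <;> assumption

theorem sl_mul_apply (M N : Matrix.SpecialLinearGroup (Fin 2) ℤ) (i j : Fin 2) :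
    (M * N) i j = M i 0 * N 0 j + M i 1 * N 1 j := by
  rw [Matrix.SpecialLinearGroup.coe_mul, Matrix.mul_apply, Fin.sum_univ_two]

theorem sl_neg_apply (M : Matrix.SpecialLinearGroup (Fin 2) ℤ) (i j : Fin 2) :
    (-M) i j = -M i j := by
  rw [Matrix.SpecialLinearGroup.coe_neg, Matrix.neg_apply]

/-- Cayley–Hamilton. -/
theorem coe_sq_eq (M : Matrix.SpecialLinearGroup (Fin 2) ℤ) :
    (M : Matrix (Fin 2) (Fin 2) ℤ) ^ 2 = (M 0 0 + M 1 1) • (M : Matrix (Fin 2) (Fin 2) ℤ) - 1 := by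
  have := det_eq_one M
  rw [pow_two]
  ext i j
  fin_cases i <;> fin_cases j <;> simp [Matrix.mul_apply, Fin.sum_univ_two, -zsmul_eq_mul] <;>
    first | ring1 | linear_combination -this

theorem eq_one_or_eq_neg_one_of_isOfFinOrder {M : Matrix.SpecialLinearGroup (Fin 2) ℤ}
    (ht : 2 ≤ M 0 0 + M 1 1) (hM : IsOfFinOrder M) : M = 1 ∨ M = -1 := by
  have key : ∀ k : ℕ, ∃ s s' : ℤ, 0 ≤ s' ∧ s' < s ∧
      (M : Matrix (Fin 2) (Fin 2) ℤ) ^ (k + 1) = s • (M : Matrix (Fin 2) (Fin 2) ℤ) - s' • 1 := by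
    intro k
    induction k with
    | zero => exact ⟨1, 0, by simp⟩
    | succ k ih =>
      obtain ⟨s, s', h0, h1, h⟩ := ih
      refine ⟨s * (M 0 0 + M 1 1) - s', s, by lia, by nlinarith, ?_⟩
      rw [pow_succ, h, sub_mul, smul_mul_assoc, ← pow_two, coe_sq_eq]
      simp only [smul_sub, smul_smul, sub_smul, smul_mul_assoc, one_mul]
      abel
  obtain ⟨n, hn, h⟩ := isOfFinOrder_iff_pow_eq_one.1 hM
  obtain ⟨s, s', h0, h1, hs⟩ := key (n - 1)
  rw [Nat.sub_add_cancel hn, ← Matrix.SpecialLinearGroup.coe_pow, h] at hs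
  have e := fun i j => congrFun (congrFun hs i) j
  have e00 := e 0 0
  have e01 := e 0 1
  have e10 := e 1 0
  have e11 := e 1 1
  simp only [Matrix.SpecialLinearGroup.coe_one, Matrix.sub_apply, Matrix.smul_apply, smul_eq_mul,
    Matrix.one_apply_eq, Matrix.one_apply_ne zero_ne_one, Matrix.one_apply_ne one_ne_zero,
    mul_one, mul_zero, sub_zero] at e00 e01 e10 e11
  have hs0 : s ≠ 0 := by lia
  have b0 : M 0 1 = 0 := by simpa [hs0] using e01
  have c0 : M 1 0 = 0 := by simpa [hs0] using e10
  have ad : M 0 0 = M 1 1 := mul_left_cancel₀ hs0 (by lia)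
  have hd := det_eq_one M
  rw [b0, zero_mul, sub_zero, ad] at hd
  rcases Int.eq_one_or_neg_one_of_mul_eq_one hd with h | h
  · left; exact sl_ext (by simp [ad, h]) (by simp [b0]) (by simp [c0]) (by simp [h])
  · right; exact sl_ext (by simp [ad, h]) (by simp [b0]) (by simp [c0]) (by simp [h])

theorem isOfFinOrder_neg {M : Matrix.SpecialLinearGroup (Fin 2) ℤ} (hM : IsOfFinOrder M) :
    IsOfFinOrder (-M) := by
  obtain ⟨n, hn, h⟩ := isOfFinOrder_iff_pow_eq_one.1 hM
  refine isOfFinOrder_iff_pow_eq_one.2 ⟨n * 2, by lia, ?_⟩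
  rw [mul_comm, pow_mul, neg_sq, ← pow_mul, mul_comm, pow_mul, h, one_pow]

theorem isOfFinOrder_mk {M : Matrix.SpecialLinearGroup (Fin 2) ℤ} :
    IsOfFinOrder (mk M) ↔ IsOfFinOrder M := by
  refine ⟨fun h => ?_, fun h => mk.isOfFinOrder h⟩
  obtain ⟨n, hn, h⟩ := isOfFinOrder_iff_pow_eq_one.1 h
  rw [← map_pow, mk_eq_one] at h
  refine isOfFinOrder_iff_pow_eq_one.2 ⟨n * 2, by lia, ?_⟩
  rw [pow_mul]
  rcases h with h | h <;> simp [h]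

theorem abs_trace_le_one {M : Matrix.SpecialLinearGroup (Fin 2) ℤ} (hM : IsOfFinOrder M)
    (h1 : mk M ≠ 1) : -1 ≤ M 0 0 + M 1 1 ∧ M 0 0 + M 1 1 ≤ 1 := by
  by_contra h
  apply h1
  rw [mk_eq_one]
  by_cases h2 : 2 ≤ M 0 0 + M 1 1
  · exact eq_one_or_eq_neg_one_of_isOfFinOrder h2 hM
  · have := eq_one_or_eq_neg_one_of_isOfFinOrder (M := -M)
      (by rw [sl_neg_apply, sl_neg_apply]; lia) (isOfFinOrder_neg hM)
    rwa [neg_eq_iff_eq_neg, neg_inj, or_comm] at this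

theorem isOfFinOrder_of_abs_trace_le_one {M : Matrix.SpecialLinearGroup (Fin 2) ℤ}
    (h1 : -1 ≤ M 0 0 + M 1 1) (h2 : M 0 0 + M 1 1 ≤ 1) : IsOfFinOrder M := by
  refine isOfFinOrder_iff_pow_eq_one.2 ⟨12, by simp, Subtype.ext ?_⟩
  rw [Matrix.SpecialLinearGroup.coe_pow, Matrix.SpecialLinearGroup.coe_one]
  have h := coe_sq_eq M
  generalize (M : Matrix (Fin 2) (Fin 2) ℤ) = A at *
  obtain h3 | h3 | h3 : A 0 0 + A 1 1 = -1 ∨ A 0 0 + A 1 1 = 0 ∨ A 0 0 + A 1 1 = 1 := by lia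
  · have h3 : A ^ 3 = 1 := by
      rw [pow_succ, h, h3]; rw [h3] at h; simp only [sub_mul, smul_mul_assoc, ← pow_two, h]; simp
    rw [show 12 = 3 * 4 from rfl, pow_mul, h3, one_pow]
  · have h3 : A ^ 2 = -1 := by rw [h, h3]; simp
    rw [show 12 = 2 * 6 from rfl, pow_mul, h3]; simp [Even.neg_pow (by decide : Even 6)]
  · have h3 : A ^ 3 = -1 := by
      rw [pow_succ, h, h3]; rw [h3] at h; simp only [sub_mul, smul_mul_assoc, ← pow_two, h]; simp
    rw [show 12 = 3 * 4 from rfl, pow_mul, h3]; simp [Even.neg_pow (by decide : Even 4)]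

theorem isOfFinOrder_of_commute {M N : Matrix.SpecialLinearGroup (Fin 2) ℤ} (hM : IsOfFinOrder M)
    (hM1 : mk M ≠ 1) (h : M * N = N * M) : IsOfFinOrder N := by
  obtain ⟨t1, t2⟩ := abs_trace_le_one hM hM1
  have dM := det_eq_one M
  have dN := det_eq_one N
  have e := fun i j => congrArg (fun X : Matrix.SpecialLinearGroup (Fin 2) ℤ => X i j) h
  have e00 := e 0 0
  have e01 := e 0 1
  have e10 := e 1 0
  simp only [sl_mul_apply] at e00 e01 e10
  by_contra hN
  have hN1 : mk N ≠ 1 := fun h => hN (isOfFinOrder_mk.1 (h ▸ IsOfFinOrder.one))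
  apply hN
  rw [Ne, mk_eq_one] at hN1
  have hsl : ∀ X : Matrix.SpecialLinearGroup (Fin 2) ℤ, X 0 1 = 0 → X 1 0 = 0 → X 0 0 = X 1 1 →
      X 0 0 * X 1 1 - X 0 1 * X 1 0 = 1 → X = 1 ∨ X = -1 := fun X b c d hd => by
    rw [b, zero_mul, sub_zero, d] at hd
    rcases Int.eq_one_or_neg_one_of_mul_eq_one hd with h | h
    · left; exact sl_ext (by simp [d, h]) (by simp [b]) (by simp [c]) (by simp [h])
    · right; exact sl_ext (by simp [d, h]) (by simp [b]) (by simp [c]) (by simp [h])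
  have hN2 := fun b c d => hN1 (hsl N b c d dN)
  clear hN1 hsl hM1 hM hN e h
  have hsq : (M 0 0 + M 1 1) ^ 2 ≤ 1 := by nlinarith
  generalize M 0 0 = a, M 0 1 = b, M 1 0 = c, M 1 1 = d at *
  have hdisc : (a - d) ^ 2 + 4 * (b * c) < 0 := by nlinarith
  have hbc : b * c < 0 := by nlinarith [sq_nonneg (a - d)]
  have key : (b * c) * ((N 0 0 - N 1 1) ^ 2 + 4 * (N 0 1 * N 1 0)) =
      (N 0 1 * N 1 0) * ((a - d) ^ 2 + 4 * (b * c)) := by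
    have u : b * N 1 0 = c * N 0 1 := by linarith
    have v : (a - d) * N 0 1 = b * (N 0 0 - N 1 1) := by linarith
    have w : (a - d) * N 1 0 = c * (N 0 0 - N 1 1) := by linarith
    linear_combination -(c * (N 0 0 - N 1 1)) * v - ((a - d) * N 0 1) * w
  have hb : b ≠ 0 := by rintro rfl; simp at hbc
  have hc : c ≠ 0 := by rintro rfl; simp at hbc
  have hfg : N 0 1 * N 1 0 < 0 := by
    have u : b * N 1 0 = c * N 0 1 := by linarith
    have h1 : (b * c) * (N 0 1 * N 1 0) = (c * N 0 1) ^ 2 := by linear_combination (c * N 0 1) * u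
    by_contra hge
    push Not at hge
    have h2 : (c * N 0 1) ^ 2 ≤ 0 := by rw [← h1]; exact mul_nonpos_of_nonpos_of_nonneg hbc.le hge
    have h3 : c * N 0 1 = 0 := by nlinarith
    have f0 : N 0 1 = 0 := by simpa [hc] using h3
    have g0 : N 1 0 = 0 := by simpa [hb, f0] using u
    refine hN2 f0 g0 ?_
    have v : b * (N 0 0 - N 1 1) = 0 := by rw [f0] at e01; linarith
    have := (mul_eq_zero.1 v).resolve_left hb
    linarith
  have hN3 : (N 0 0 - N 1 1) ^ 2 + 4 * (N 0 1 * N 1 0) < 0 := by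
    by_contra hge
    push Not at hge
    nlinarith [mul_pos_of_neg_of_neg hfg hdisc]
  have hN4 : (N 0 0 + N 1 1) ^ 2 < 4 := by nlinarith
  exact isOfFinOrder_of_abs_trace_le_one (by nlinarith) (by nlinarith)

/-- The centralizer of a nontrivial torsion element of `PSL(2, ℤ)` is a torsion group. -/
theorem isOfFinOrder_of_commute_mk {x y : PSL2Z} (hx1 : x ≠ 1) (hx : IsOfFinOrder x)
    (h : Commute x y) : IsOfFinOrder y := by
  obtain ⟨M, rfl⟩ := mk_surjective x
  obtain ⟨N, rfl⟩ := mk_surjective y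
  have h' : M * N = N * M ∨ M * N = -(N * M) := by
    rw [← mk_eq_mk, map_mul, map_mul]; exact h
  rw [isOfFinOrder_mk] at hx ⊢
  have h2 : M * (N * N) = N * N * M := by
    rcases h' with h | h
    · rw [← mul_assoc, h, mul_assoc, h, mul_assoc]
    · rw [← mul_assoc, h, neg_mul, mul_assoc, h, mul_neg, neg_neg, mul_assoc]
  have h3 := isOfFinOrder_of_commute hx hx1 h2
  rw [← pow_two] at h3
  exact (isOfFinOrder_pow.1 h3).resolve_right (by simp)

/-- Reduction modulo two. -/
def modTwo : PSL2Z →* Matrix.SpecialLinearGroup (Fin 2) (ZMod 2) :=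
  QuotientGroup.lift _ (Matrix.SpecialLinearGroup.map (Int.castRingHom (ZMod 2))) fun M hM => by
    have : mk M = 1 := (QuotientGroup.eq_one_iff M).2 hM
    rcases mk_eq_one.1 this with rfl | rfl
    · exact map_one _
    · ext i j; fin_cases i <;> fin_cases j <;> simp

theorem modTwo_mk_apply (M : Matrix.SpecialLinearGroup (Fin 2) ℤ) (i j : Fin 2) :
    modTwo (mk M) i j = (M i j : ZMod 2) := rfl

/-- The kernel of reduction modulo two is torsion-free. -/
theorem eq_one_of_modTwo_eq_one {x : PSL2Z} (hx : IsOfFinOrder x) (h : modTwo x = 1) : x = 1 := by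
  obtain ⟨M, rfl⟩ := mk_surjective x
  by_contra h1
  obtain ⟨t1, t2⟩ := abs_trace_le_one (isOfFinOrder_mk.1 hx) h1
  have d := det_eq_one M
  have e := fun i j => congrArg (fun X : Matrix.SpecialLinearGroup (Fin 2) (ZMod 2) => X i j) h
  have e00 := e 0 0
  have e01 := e 0 1
  have e10 := e 1 0
  have e11 := e 1 1
  simp only [modTwo_mk_apply] at e00 e01 e10 e11
  obtain ⟨a, ha⟩ := (ZMod.intCast_eq_intCast_iff_dvd_sub 1 (M 0 0) 2).1 (by simp [e00])
  obtain ⟨d', hd⟩ := (ZMod.intCast_eq_intCast_iff_dvd_sub 1 (M 1 1) 2).1 (by simp [e11])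
  obtain ⟨b, hb⟩ := (ZMod.intCast_eq_intCast_iff_dvd_sub 0 (M 0 1) 2).1 (by simp [e01])
  obtain ⟨c, hc⟩ := (ZMod.intCast_eq_intCast_iff_dvd_sub 0 (M 1 0) 2).1 (by simp [e10])
  push_cast at ha hd hb hc
  have ha' : M 0 0 = 2 * a + 1 := by linarith
  have hd' : M 1 1 = 2 * d' + 1 := by linarith
  have hb' : M 0 1 = 2 * b := by linarith
  have hc' : M 1 0 = 2 * c := by linarith
  rw [ha', hd', hb', hc'] at d
  rw [ha', hd'] at t1 t2
  have hs : a + d' = -1 := by lia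
  have hd2 : d' = -1 - a := by lia
  subst hd2
  have : 2 * (b * c - a * (-1 - a)) = -1 := by linarith
  lia

theorem not_isOfFinOrder_of_trace {M L : Matrix.SpecialLinearGroup (Fin 2) ℤ}
    (hM : M 0 0 + M 1 1 = 0) (hL : L 0 0 + L 1 1 = 1 ∨ L 0 0 + L 1 1 = -1)
    (hML : (M * L) 0 0 + (M * L) 1 1 = 0) : False := by
  wlog hL1 : L 0 0 + L 1 1 = 1 generalizing L
  · refine this (L := -L) ?_ ?_ ?_ <;> simp only [mul_neg, sl_neg_apply] <;> lia
  have dM := det_eq_one M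
  have dL := det_eq_one L
  simp only [sl_mul_apply] at hML
  have h1 : M 1 1 = -M 0 0 := by lia
  have h2 : L 1 1 = 1 - L 0 0 := by lia
  rw [h1] at dM hML
  rw [h2] at dL hML
  generalize M 0 0 = a, M 0 1 = b, M 1 0 = c, L 0 0 = e, L 0 1 = f, L 1 0 = g at *
  have h3 : (b * g + c * f) ^ 2 = (a * (2 * e - 1)) ^ 2 := by
    rw [show b * g + c * f = -(a * (2 * e - 1)) by linarith]; ring
  have h4 : b * c = -(1 + a ^ 2) := by linarith
  have h5 : 4 * (f * g) = -(3 + (2 * e - 1) ^ 2) := by linear_combination -4 * dL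
  have h6 : (b * g + c * f) ^ 2 = (b * g - c * f) ^ 2 + (b * c) * (4 * (f * g)) := by ring
  rw [h3, h4, h5] at h6
  nlinarith [sq_nonneg (b * g - c * f), sq_nonneg a, sq_nonneg (2 * e - 1)]

theorem sl2_two_cases : ∀ x : Matrix.SpecialLinearGroup (Fin 2) (ZMod 2),
    (x ^ 3 = 1 ∧ (x ≠ 1 → x 0 0 + x 1 1 = 1)) ∨ (x ^ 2 = 1 ∧ x 0 0 + x 1 1 = 0) := by
  decide

/-- A torsion subgroup of `PSL(2, ℤ)` does not contain both an element of order two and an element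
of order three. -/
theorem not_sq_and_cube {x y : PSL2Z} (hx : IsOfFinOrder x) (hy : IsOfFinOrder y)
    (hxy : IsOfFinOrder (x * y)) (h2 : modTwo x ≠ 1) (h2' : modTwo x ^ 2 = 1)
    (h3 : modTwo y ≠ 1) (h3' : modTwo y ^ 3 = 1) : False := by
  have key : ∀ x y : Matrix.SpecialLinearGroup (Fin 2) (ZMod 2),
    (x ≠ 1 ∧ x ^ 2 = 1) ∧ (y ≠ 1 ∧ y ^ 3 = 1) →
    x 0 0 + x 1 1 = 0 ∧ y 0 0 + y 1 1 = 1 ∧ (x * y) 0 0 + (x * y) 1 1 = 0 ∧ x * y ≠ 1 := by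
    set_option maxRecDepth 10000 in decide
  obtain ⟨k1, k2, k3, k4⟩ := key _ _ ⟨⟨h2, h2'⟩, h3, h3'⟩
  rw [← map_mul] at k3 k4
  have hx1 : x ≠ 1 := fun h => h2 (by rw [h, map_one])
  have hy1 : y ≠ 1 := fun h => h3 (by rw [h, map_one])
  have hxy1 : x * y ≠ 1 := fun h => k4 (by rw [h, map_one])
  obtain ⟨M, rfl⟩ := mk_surjective x
  obtain ⟨L, rfl⟩ := mk_surjective y
  rw [← map_mul] at hxy k3 hxy1
  simp only [modTwo_mk_apply, ← Int.cast_add] at k1 k2 k3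
  obtain ⟨a1, a2⟩ := abs_trace_le_one (isOfFinOrder_mk.1 hx) hx1
  obtain ⟨b1, b2⟩ := abs_trace_le_one (isOfFinOrder_mk.1 hy) hy1
  obtain ⟨c1, c2⟩ := abs_trace_le_one (isOfFinOrder_mk.1 hxy) hxy1
  have k1' := (ZMod.intCast_zmod_eq_zero_iff_dvd _ 2).1 k1
  have k3' := (ZMod.intCast_zmod_eq_zero_iff_dvd _ 2).1 k3
  have k2' := (ZMod.intCast_eq_intCast_iff_dvd_sub 1 _ 2).1 (by rw [k2, Int.cast_one])
  refine not_isOfFinOrder_of_trace (M := M) (L := L) ?_ ?_ ?_ <;> lia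

end PSL2Z

end ModularGroup

section Quaternion

namespace QuaternionGroup

variable {G : Type*} [Group G] {n : ℕ} {x y : G}

theorem conj_zpow_of_inv (hxy : x * y = y * x⁻¹) (k : ℤ) : x ^ k * y = y * x ^ (-k) := by
  have h : SemiconjBy y x⁻¹ x := hxy.symm
  rw [zpow_neg, ← inv_zpow]
  exact (h.zpow_right k).eq.symm

/-- The homomorphism out of a dicyclic group determined by two elements satisfying its defining
relations. -/
def lift (hx : x ^ (2 * n) = 1) (hy : y ^ 2 = x ^ n) (hxy : x * y = y * x⁻¹) :
    QuaternionGroup n →* G :=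
  let F : ZMod (2 * n) →+ Additive G := ZMod.lift (2 * n)
    ⟨zmultiplesHom (Additive G) (Additive.ofMul x), by
      rw [zmultiplesHom_apply, ← ofMul_zpow, zpow_natCast, hx, ofMul_one]⟩
  have hF (k : ℤ) : (F k).toMul = x ^ k := by
    simp only [F, ZMod.lift_coe, zmultiplesHom_apply, toMul_zsmul, toMul_ofMul]
  MonoidHom.mk' (fun
    | a i => (F i).toMul
    | xa i => y * (F i).toMul) (by
    have hc (k : ℤ) := conj_zpow_of_inv hxy k
    have hy' : y * y = x ^ (n : ℤ) := by rw [← pow_two, hy, zpow_natCast]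
    rintro (i | i) (j | j) <;> obtain ⟨i, rfl⟩ := ZMod.intCast_surjective i <;>
      obtain ⟨j, rfl⟩ := ZMod.intCast_surjective j
    · rw [a_mul_a, ← Int.cast_add]
      simp only [hF, zpow_add]
    · rw [a_mul_xa, ← Int.cast_sub]
      simp only [hF]
      rw [← mul_assoc, hc, mul_assoc, ← zpow_add, neg_add_eq_sub]
    · rw [xa_mul_a, ← Int.cast_add]
      simp only [hF, zpow_add, mul_assoc]
    · rw [xa_mul_xa, ← Int.cast_natCast, ← Int.cast_add, ← Int.cast_sub]
      simp only [hF]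
      rw [mul_assoc, ← mul_assoc (x ^ i), hc, mul_assoc, ← mul_assoc y, hy', ← zpow_add,
        ← zpow_add]
      congr 1
      ring)

theorem lift_a (hx : x ^ (2 * n) = 1) (hy : y ^ 2 = x ^ n) (hxy : x * y = y * x⁻¹) (k : ℤ) :
    lift hx hy hxy (a k) = x ^ k := by
  simp only [lift, MonoidHom.mk'_apply, ZMod.lift_coe, zmultiplesHom_apply, toMul_zsmul,
    toMul_ofMul]

theorem lift_xa (hx : x ^ (2 * n) = 1) (hy : y ^ 2 = x ^ n) (hxy : x * y = y * x⁻¹) (k : ℤ) :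
    lift hx hy hxy (xa k) = y * x ^ k := by
  simp only [lift, MonoidHom.mk'_apply, ZMod.lift_coe, zmultiplesHom_apply, toMul_zsmul,
    toMul_ofMul]

theorem lift_range (hx : x ^ (2 * n) = 1) (hy : y ^ 2 = x ^ n) (hxy : x * y = y * x⁻¹) :
    (lift hx hy hxy).range = Subgroup.closure {x, y} := by
  have h1 : lift hx hy hxy (a 1) = x := by simpa using lift_a hx hy hxy 1
  have h2 : lift hx hy hxy (xa 0) = y := by simpa using lift_xa hx hy hxy 0
  apply le_antisymm
  · rintro _ ⟨i | i, rfl⟩ <;> obtain ⟨k, rfl⟩ := ZMod.intCast_surjective i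
    · rw [lift_a]
      exact zpow_mem (Subgroup.subset_closure (by simp)) k
    · rw [lift_xa]
      exact mul_mem (Subgroup.subset_closure (by simp))
        (zpow_mem (Subgroup.subset_closure (by simp)) k)
  · rw [Subgroup.closure_le, Set.insert_subset_iff, Set.singleton_subset_iff]
    exact ⟨⟨_, h1⟩, ⟨_, h2⟩⟩

end QuaternionGroup

end Quaternion

section SphereBraids

theorem conj_p_q {G : Type*} [Group G] {s₁ s₂ s₃ : G}
    (h₁₂ : s₁ * s₂ * s₁ = s₂ * s₁ * s₂) (h₂₃ : s₂ * s₃ * s₂ = s₃ * s₂ * s₃) :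
    s₁ * (s₂ * (s₁ * s₃⁻¹) * s₂⁻¹) * s₁⁻¹ = s₂ * (s₁ * s₃⁻¹) * s₂⁻¹ * (s₁ * s₃⁻¹)⁻¹ := by
  have h : s₂ * s₃⁻¹ * s₂⁻¹ = s₃⁻¹ * s₂⁻¹ * s₃ := by
    rw [eq_comm, ← mul_left_inj (s₂ * s₃), ← mul_right_inj (s₂ * s₃)]
    calc _ = s₃ * s₂ * s₃ := by group
      _ = _ := by rw [← h₂₃]; group
  calc _ = s₁ * s₂ * s₁ * (s₃⁻¹ * s₂⁻¹ * s₁⁻¹) := by group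
    _ = s₂ * s₁ * (s₂ * s₃⁻¹ * s₂⁻¹) * s₁⁻¹ := by rw [h₁₂]; group
    _ = _ := by rw [h]; group

theorem conj_q_by_s2 {G : Type*} [Group G] {s₁ s₂ p q : G} (h₁₂ : s₁ * s₂ * s₁ = s₂ * s₁ * s₂)
    (hp : s₁ * p * s₁⁻¹ = p) (hq : s₁ * q * s₁⁻¹ = q * p⁻¹) (hpq : s₂ * p * s₂⁻¹ = q) :
    s₂ * q * s₂⁻¹ = q * p⁻¹ * q := by
  have e : s₂ * (q * p⁻¹) * s₂⁻¹ = q * p⁻¹ := by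
    calc _ = s₂ * s₁ * s₂ * p * (s₂ * s₁ * s₂)⁻¹ := by rw [← hq, ← hpq]; group
      _ = s₁ * (s₂ * (s₁ * p * s₁⁻¹) * s₂⁻¹) * s₁⁻¹ := by rw [← h₁₂]; group
      _ = _ := by rw [hp, hpq, hq]
  calc _ = s₂ * (q * p⁻¹) * s₂⁻¹ * (s₂ * p * s₂⁻¹) := by group
    _ = _ := by rw [e, hpq]

theorem quaternion_relations {G : Type*} [Group G] {s₁ s₂ s₃ p q : G}
    (h₁₃ : s₁ * s₃ = s₃ * s₁) (h₁₂ : s₁ * s₂ * s₁ = s₂ * s₁ * s₂)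
    (hs : s₁ * s₂ * s₃ ^ 2 * s₂ * s₁ = 1) (hp3 : s₁ * s₃⁻¹ = p)
    (hp : s₁ * p * s₁⁻¹ = p) (hq : s₁ * q * s₁⁻¹ = q * p⁻¹) (hpq : s₂ * p * s₂⁻¹ = q) :
    p ^ (2 * 2) = 1 ∧ q ^ 2 = p ^ 2 ∧ p * q = q * p⁻¹ ∧ (s₁ * s₂ * s₁) ^ 2 = p ^ 2 := by
  have hr : (s₁ * s₂) * p * (s₁ * s₂)⁻¹ = q * p⁻¹ := by
    calc _ = s₁ * (s₂ * p * s₂⁻¹) * s₁⁻¹ := by group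
      _ = _ := by rw [hpq, hq]
  have hΔ : (s₁ * s₂ * s₁) ^ 2 = (q * p⁻¹) ^ 2 := by
    have c : s₃ ^ 2 = (p ^ 2)⁻¹ * s₁ ^ 2 := by
      have e : s₃ = p⁻¹ * s₁ := by
        rw [← hp3, mul_inv_rev, inv_inv, eq_mul_inv_iff_mul_eq.2 h₁₃.symm]
        group
      have hc : Commute s₁ p := mul_inv_eq_iff_eq_mul.1 hp
      rw [e, (hc.symm.inv_left).mul_pow, inv_pow]
    rw [← hr, conj_pow, ← mul_right_inj (s₁ * s₂ * (p ^ 2)⁻¹ * (s₁ * s₂)⁻¹)]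
    calc _ = s₁ * s₂ * ((p ^ 2)⁻¹ * s₁ ^ 2) * s₂ * s₁ := by
          rw [pow_two (s₁ * s₂ * s₁), pow_two s₁]; group
      _ = 1 := by rw [← c, hs]
      _ = _ := by group
  have c1 : s₁ * (s₁ * s₂ * s₁) ^ 2 = (s₁ * s₂ * s₁) ^ 2 * s₁ := by
    rw [pow_two]
    calc _ = s₁ * (s₁ * s₂ * s₁) * (s₁ * s₂ * s₁) := by group
      _ = s₁ * s₂ * s₁ * s₂ * (s₁ * s₂ * s₁) := by nth_rw 1 [h₁₂]; simp only [mul_assoc]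
      _ = s₁ * s₂ * s₁ * (s₂ * s₁ * s₂) * s₁ := by group
      _ = _ := by rw [← h₁₂, mul_assoc]
  have c2 : s₂ * (s₁ * s₂ * s₁) ^ 2 = (s₁ * s₂ * s₁) ^ 2 * s₂ := by
    rw [pow_two]
    calc _ = (s₂ * s₁ * s₂) * s₁ * (s₁ * s₂ * s₁) := by group
      _ = s₁ * s₂ * s₁ * s₁ * (s₂ * s₁ * s₂) := by rw [← h₁₂]
      _ = _ := by group
  have hΔq : (s₁ * s₂ * s₁) ^ 2 = q ^ 2 := by
    rw [← mul_right_inj s₁, ← mul_left_inj s₁⁻¹, mul_inv_eq_iff_eq_mul.2 c1, ← conj_pow, hq, hΔ]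
  have hΔp : (s₁ * s₂ * s₁) ^ 2 = p ^ 2 := by
    have := mul_inv_eq_iff_eq_mul.2 c2
    rw [hΔq] at this ⊢
    nth_rw 2 [← hpq] at this
    rw [conj_pow, mul_left_inj, mul_right_inj] at this
    exact this
  have e1 : q ^ 2 = p ^ 2 := hΔq.symm.trans hΔp
  have e2 : p * q = q * p⁻¹ := by
    have e := hΔ.symm.trans hΔq
    rw [pow_two, pow_two, mul_assoc, mul_right_inj] at e
    rw [← mul_right_inj p⁻¹, ← mul_assoc p⁻¹, inv_mul_cancel, one_mul]
    simpa [mul_assoc] using e.symm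
  refine ⟨?_, e1, e2, hΔp⟩
  have e3 : p ^ 2 * q = q * (p ^ 2)⁻¹ := by
    rw [pow_two, mul_assoc, e2, ← mul_assoc, e2]
    group
  rw [← e1] at e3
  have e4 : q ^ 2 * q ^ 2 = 1 := by
    rw [← mul_left_inj q, mul_assoc _ _ q, e3]
    group
  rw [pow_mul, ← e1, pow_two, e4]

namespace B4S2

theorem mk_eq_one {r : FreeGroup (Fin 3)} (h : r ∈ sphereBraidRels) :
    PresentedGroup.mk sphereBraidRels r = 1 :=
  (PresentedGroup.mk_eq_one_iff).2 (Subgroup.subset_normalClosure h)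

theorem comm_σ : σ 0 * σ 2 = σ 2 * σ 0 := by
  have := mk_eq_one (r := FreeGroup.of 0 * FreeGroup.of 2 * (FreeGroup.of 2 * FreeGroup.of 0)⁻¹)
    (by simp [sphereBraidRels])
  rw [map_mul, map_inv, mul_inv_eq_one] at this
  exact this

theorem braid_σ₀ : σ 0 * σ 1 * σ 0 = σ 1 * σ 0 * σ 1 := by
  have := mk_eq_one (r := FreeGroup.of 0 * FreeGroup.of 1 * FreeGroup.of 0 *
      (FreeGroup.of 1 * FreeGroup.of 0 * FreeGroup.of 1)⁻¹) (by simp [sphereBraidRels])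
  rw [map_mul, map_inv, mul_inv_eq_one] at this
  exact this

theorem braid_σ₁ : σ 1 * σ 2 * σ 1 = σ 2 * σ 1 * σ 2 := by
  have := mk_eq_one (r := FreeGroup.of 1 * FreeGroup.of 2 * FreeGroup.of 1 *
      (FreeGroup.of 2 * FreeGroup.of 1 * FreeGroup.of 2)⁻¹) (by simp [sphereBraidRels])
  rw [map_mul, map_inv, mul_inv_eq_one] at this
  exact this

theorem sphere_σ : σ 0 * σ 1 * σ 2 ^ 2 * σ 1 * σ 0 = 1 :=
  mk_eq_one (r := FreeGroup.of 0 * FreeGroup.of 1 * FreeGroup.of 2 ^ 2 * FreeGroup.of 1 *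
    FreeGroup.of 0) (by simp [sphereBraidRels])

theorem closure_σ : Subgroup.closure {σ 0, σ 1, σ 2} = ⊤ := by
  rw [← PresentedGroup.closure_range_of sphereBraidRels]
  congr 1
  ext x
  simp [σ, Fin.exists_fin_succ, eq_comm]

/-- The homomorphism out of `B₄(S²)` determined by three elements satisfying its relations. -/
def lift {G : Type*} [Group G] (s : Fin 3 → G) (h₀₂ : s 0 * s 2 = s 2 * s 0)
    (h₀₁ : s 0 * s 1 * s 0 = s 1 * s 0 * s 1) (h₁₂ : s 1 * s 2 * s 1 = s 2 * s 1 * s 2)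
    (hs : s 0 * s 1 * s 2 ^ 2 * s 1 * s 0 = 1) : B4S2 →* G :=
  PresentedGroup.toGroup (f := s) (by
    rintro r (rfl | rfl | rfl | rfl)
    · simp [h₀₂]
    · simp [h₀₁]
    · simp [h₁₂]
    · simpa using hs)

theorem lift_σ {G : Type*} [Group G] (s : Fin 3 → G) (h₀₂ : s 0 * s 2 = s 2 * s 0)
    (h₀₁ : s 0 * s 1 * s 0 = s 1 * s 0 * s 1) (h₁₂ : s 1 * s 2 * s 1 = s 2 * s 1 * s 2)
    (hs : s 0 * s 1 * s 2 ^ 2 * s 1 * s 0 = 1) (i : Fin 3) :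
    lift s h₀₂ h₀₁ h₁₂ hs (σ i) = s i :=
  PresentedGroup.toGroup.of _

/-- One of two generators of the normal quaternion subgroup of `B₄(S²)`. -/
def p : B4S2 := σ 0 * (σ 2)⁻¹

/-- One of two generators of the normal quaternion subgroup of `B₄(S²)`. -/
def q : B4S2 := σ 1 * p * (σ 1)⁻¹

theorem σ₀_conj_p : σ 0 * p * (σ 0)⁻¹ = p := by
  have h : Commute (σ 0) (σ 2) := comm_σ
  exact mul_inv_eq_iff_eq_mul.2 ((Commute.refl _).mul_right h.inv_right).eq

theorem σ₀_conj_q : σ 0 * q * (σ 0)⁻¹ = q * p⁻¹ := conj_p_q braid_σ₀ braid_σ₁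

theorem σ₁_conj_q : σ 1 * q * (σ 1)⁻¹ = q * p⁻¹ * q :=
  conj_q_by_s2 braid_σ₀ σ₀_conj_p σ₀_conj_q rfl

theorem p_q_relations : p ^ (2 * 2) = 1 ∧ q ^ 2 = p ^ 2 ∧ p * q = q * p⁻¹ ∧
    (σ 0 * σ 1 * σ 0) ^ 2 = p ^ 2 :=
  quaternion_relations comm_σ braid_σ₀ sphere_σ rfl σ₀_conj_p σ₀_conj_q rfl

/-- The homomorphism from the quaternion group into `B₄(S²)` with image generated by `p`, `q`. -/
def ι : QuaternionGroup 2 →* B4S2 :=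
  QuaternionGroup.lift p_q_relations.1 p_q_relations.2.1 p_q_relations.2.2.1

/-- The normal quaternion subgroup of `B₄(S²)`. -/
def N : Subgroup B4S2 := ι.range

theorem N_eq : N = Subgroup.closure {p, q} := QuaternionGroup.lift_range _ _ _

theorem p_mem : p ∈ N := N_eq ▸ Subgroup.subset_closure (by simp)

theorem q_mem : q ∈ N := N_eq ▸ Subgroup.subset_closure (by simp)

instance : Finite N := by
  have : Finite (QuaternionGroup 2) := Finite.of_fintype _
  exact Set.finite_range ι

theorem mem_normalizer {g : B4S2} (hp : g * p * g⁻¹ ∈ N) (hq : g * q * g⁻¹ ∈ N) :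
    g ∈ Subgroup.normalizer (N : Set B4S2) := by
  have : Finite (N : Set B4S2) := inferInstanceAs (Finite N)
  refine Subgroup.mem_normalizer_fintype fun n hn => ?_
  have h : N ≤ N.comap (MulAut.conj g).toMonoidHom := by
    nth_rw 1 [N_eq]
    rw [Subgroup.closure_le, Set.insert_subset_iff, Set.singleton_subset_iff]
    exact ⟨hp, hq⟩
  exact h hn

instance : N.Normal := by
  rw [← Subgroup.normalizer_eq_top_iff, eq_top_iff, ← closure_σ, Subgroup.closure_le]
  have h0 : σ 0 ∈ Subgroup.normalizer (N : Set B4S2) := by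
    refine mem_normalizer ?_ ?_
    · rw [σ₀_conj_p]; exact p_mem
    · rw [σ₀_conj_q]; exact mul_mem q_mem (inv_mem p_mem)
  have h1 : σ 1 ∈ Subgroup.normalizer (N : Set B4S2) := by
    refine mem_normalizer q_mem ?_
    rw [σ₁_conj_q]; exact mul_mem (mul_mem q_mem (inv_mem p_mem)) q_mem
  have h2 : σ 2 = p⁻¹ * σ 0 := by
    rw [p, mul_inv_rev, inv_inv, inv_mul_cancel_right]
  rintro _ (rfl | rfl | rfl)
  · exact h0
  · exact h1
  · rw [h2]
    exact mul_mem (inv_mem (Subgroup.le_normalizer p_mem)) h0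

end B4S2

end SphereBraids

section Kernel

namespace B4S2

/-- An element of order two modulo `N`. -/
def a : B4S2 := σ 0 * σ 1 * σ 0

/-- An element of order three modulo `N`. -/
def u : B4S2 := σ 0 * σ 1

theorem a_sq_mem : a ^ 2 ∈ N := by
  rw [a, p_q_relations.2.2.2]
  exact pow_mem p_mem 2

theorem u_cube : u ^ 3 = a ^ 2 := by
  have h : u ^ 3 = σ 0 * σ 1 * σ 0 * (σ 1 * σ 0 * σ 1) := by
    simp only [pow_succ, pow_zero, one_mul, u, mul_assoc]
  rw [h, ← braid_σ₀, pow_two, a]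

theorem σ_eq : σ 0 = u⁻¹ * a ∧ σ 1 = (u⁻¹ * a)⁻¹ * u ∧ σ 2 = p⁻¹ * (u⁻¹ * a) := by
  have h : u⁻¹ * a = σ 0 := by rw [u, a]; group
  rw [h, u, p]
  exact ⟨rfl, by group, by group⟩

theorem closure_insert_N {S : Subgroup B4S2} (hN : N ≤ S) (ha : a ∈ S) (hu : u ∈ S) : S = ⊤ := by
  rw [eq_top_iff, ← closure_σ, Subgroup.closure_le]
  have h := mul_mem (inv_mem hu) ha
  rintro _ (rfl | rfl | rfl)
  · rw [SetLike.mem_coe, σ_eq.1]; exact h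
  · rw [SetLike.mem_coe, σ_eq.2.1]; exact mul_mem (inv_mem h) hu
  · rw [SetLike.mem_coe, σ_eq.2.2]; exact mul_mem (inv_mem (hN p_mem)) h

open PSL2Z

open scoped Pointwise

/-- The integer matrix with given entries and determinant one. -/
def sl (a b c d : ℤ) (h : a * d - b * c = 1) : Matrix.SpecialLinearGroup (Fin 2) ℤ :=
  ⟨!![a, b; c, d], by rw [Matrix.det_fin_two_of, h]⟩

@[simp] theorem sl_apply_zero_zero (a b c d : ℤ) (h : a * d - b * c = 1) :
    sl a b c d h 0 0 = a := rfl

@[simp] theorem sl_apply_zero_one (a b c d : ℤ) (h : a * d - b * c = 1) :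
    sl a b c d h 0 1 = b := rfl

@[simp] theorem sl_apply_one_zero (a b c d : ℤ) (h : a * d - b * c = 1) :
    sl a b c d h 1 0 = c := rfl

@[simp] theorem sl_apply_one_one (a b c d : ℤ) (h : a * d - b * c = 1) :
    sl a b c d h 1 1 = d := rfl

/-- Matrices lifting the images of the generators of `B₄(S²)` in the modular group. -/
def braidMatrix (i : Fin 3) : Matrix.SpecialLinearGroup (Fin 2) ℤ :=
  ![sl 1 1 0 1 (by decide), sl 1 0 (-1) 1 (by decide), sl 1 1 0 1 (by decide)] i

/-- The action of `B₄(S²)` on the quotient by `N`, as a homomorphism onto the modular group. -/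
def ρ : B4S2 →* PSL2Z :=
  lift (fun i => mk (braidMatrix i)) rfl
    (by rw [← map_mul, ← map_mul, ← map_mul, ← map_mul]; exact congrArg mk (by decide))
    (by rw [← map_mul, ← map_mul, ← map_mul, ← map_mul]; exact congrArg mk (by decide))
    (by
      rw [← map_pow, ← map_mul, ← map_mul, ← map_mul, ← map_mul, PSL2Z.mk_eq_one]
      right
      decide)

theorem ρ_σ (i : Fin 3) : ρ (σ i) = mk (braidMatrix i) := lift_σ ..

theorem ρ_a : ρ a = mk (sl 0 1 (-1) 0 (by decide)) := by
  rw [a, map_mul, map_mul, ρ_σ, ρ_σ, ← map_mul, ← map_mul]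
  exact congrArg mk (by decide)

theorem ρ_u : ρ u = mk (sl 0 1 (-1) 1 (by decide)) := by
  rw [u, map_mul, ρ_σ, ρ_σ, ← map_mul]
  exact congrArg mk (by decide)

theorem N_le_ker : N ≤ ρ.ker := by
  have hp : ρ p = 1 := by
    rw [p, map_mul, map_inv, ρ_σ, ρ_σ]
    exact mul_inv_cancel _
  rw [N_eq, Subgroup.closure_le]
  rintro _ (rfl | rfl)
  · exact hp
  · rw [SetLike.mem_coe, MonoidHom.mem_ker, q, map_mul, map_mul, hp, map_inv, mul_one,
      mul_inv_cancel]

/-- The homomorphism `ρ` on the quotient by `N`. -/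
def ρbar : B4S2 ⧸ N →* PSL2Z := QuotientGroup.lift N ρ fun _ h => N_le_ker h

/-- The two ping-pong domains in `PSL(2, ℤ)`. -/
def pingPongSet (b : Bool) : Set PSL2Z :=
  {x | ∃ g, mk g = x ∧ 0 < (bif b then 1 else -1) * (g 0 0 * g 1 0)}

theorem pingPong_mul {b b' : Bool} (M : Matrix.SpecialLinearGroup (Fin 2) ℤ)
    (h : ∀ g : Matrix.SpecialLinearGroup (Fin 2) ℤ,
      0 < (bif b then 1 else -1) * (g 0 0 * g 1 0) →
      0 < (bif b' then 1 else -1) * ((M * g) 0 0 * (M * g) 1 0)) :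
    mk M • pingPongSet b ⊆ pingPongSet b' := by
  rintro _ ⟨_, ⟨g, rfl, hg⟩, rfl⟩
  exact ⟨M * g, map_mul _ _ _, h g hg⟩

/-- The two cyclic free factors of the quotient by `N`. -/
def factor (b : Bool) : Subgroup (B4S2 ⧸ N) :=
  Subgroup.zpowers (bif b then (u : B4S2 ⧸ N) else (a : B4S2 ⧸ N))

theorem a_bar_sq : (a : B4S2 ⧸ N) ^ 2 = 1 := by
  rw [← QuotientGroup.mk_pow, QuotientGroup.eq_one_iff]
  exact a_sq_mem

theorem u_bar_cube : (u : B4S2 ⧸ N) ^ 3 = 1 := by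
  rw [← QuotientGroup.mk_pow, u_cube, QuotientGroup.eq_one_iff]
  exact a_sq_mem

theorem factor_true_cases {x : B4S2 ⧸ N} (hx : x ∈ factor true) (h1 : x ≠ 1) :
    x = u ∨ x = (u : B4S2 ⧸ N) ^ 2 := by
  obtain ⟨k, rfl⟩ := hx
  simp only [cond_true] at h1 ⊢
  have e : (u : B4S2 ⧸ N) ^ k = (u : B4S2 ⧸ N) ^ (k % 3) := by
    conv_lhs => rw [← Int.emod_add_mul_ediv k 3, zpow_add, zpow_mul]
    rw [zpow_ofNat _ 3, u_bar_cube, one_zpow, mul_one]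
  rw [e] at h1 ⊢
  have := Int.emod_nonneg k (b := 3) (by lia)
  have := Int.emod_lt_of_pos k (b := 3) (by lia)
  generalize k % 3 = r at *
  interval_cases r
  · simp at h1
  · simp
  · right; rfl

theorem factor_false_cases {x : B4S2 ⧸ N} (hx : x ∈ factor false) (h1 : x ≠ 1) : x = a := by
  obtain ⟨k, rfl⟩ := hx
  simp only [cond_false] at h1 ⊢
  have e : (a : B4S2 ⧸ N) ^ k = (a : B4S2 ⧸ N) ^ (k % 2) := by
    conv_lhs => rw [← Int.emod_add_mul_ediv k 2, zpow_add, zpow_mul]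
    rw [zpow_ofNat _ 2, a_bar_sq, one_zpow, mul_one]
  rw [e] at h1 ⊢
  rcases Int.emod_two_eq_zero_or_one k with h | h <;> rw [h] at h1 ⊢
  · simp at h1
  · simp

theorem three_le_factor : 3 ≤ Cardinal.mk (factor true) := by
  have h : orderOf (u : B4S2 ⧸ N) = 3 := by
    refine orderOf_eq_prime u_bar_cube fun h => ?_
    have h' : ρbar (u : B4S2 ⧸ N) = ρ u := rfl
    rw [h, map_one, ρ_u, eq_comm, PSL2Z.mk_eq_one] at h'
    revert h'
    decide
  have hc : Nat.card (factor true) = 3 := by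
    exact (Nat.card_zpowers (u : B4S2 ⧸ N)).trans h
  have : Finite (factor true) := Nat.finite_of_card_ne_zero (by lia)
  rw [← Nat.cast_card, hc]
  rfl

theorem ρbar_injective : Function.Injective ρbar := by
  let F : Monoid.CoprodI (fun b => factor b) →* B4S2 ⧸ N :=
    Monoid.CoprodI.lift fun b => (factor b).subtype
  have hF (b : Bool) (x : factor b) : F (Monoid.CoprodI.of x) = x :=
    Monoid.CoprodI.lift_of _ _
  have hsurj : Function.Surjective F := by
    have h : F.range.comap (QuotientGroup.mk' N) = ⊤ := by
      refine closure_insert_N (fun n hn => ?_) ?_ ?_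
      · rw [Subgroup.mem_comap, QuotientGroup.mk'_apply, (QuotientGroup.eq_one_iff n).2 hn]
        exact one_mem _
      · exact ⟨_, hF false ⟨_, Subgroup.mem_zpowers _⟩⟩
      · exact ⟨_, hF true ⟨_, Subgroup.mem_zpowers _⟩⟩
    intro x
    obtain ⟨b, rfl⟩ := QuotientGroup.mk_surjective x
    have hb : b ∈ F.range.comap (QuotientGroup.mk' N) := h ▸ Subgroup.mem_top b
    exact hb
  have hinj : Function.Injective (ρbar.comp F) := by
    have e : ρbar.comp F = Monoid.CoprodI.lift fun b => ρbar.comp (factor b).subtype := by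
      ext b x
      simp [F]
    rw [e]
    refine Monoid.CoprodI.lift_injective_of_ping_pong _ (Or.inr ⟨true, three_le_factor⟩)
      pingPongSet ?_ ?_ ?_
    · rintro (_ | _)
      · exact ⟨_, sl 1 0 (-1) 1 (by decide), rfl, by decide⟩
      · exact ⟨_, sl 1 0 1 1 (by decide), rfl, by decide⟩
    · have key : Disjoint (pingPongSet false) (pingPongSet true) := by
        rw [Set.disjoint_left]
        rintro _ ⟨g, rfl, hg⟩ ⟨g', h, hg'⟩
        have e : g' 0 0 * g' 1 0 = g 0 0 * g 1 0 := by
          rcases (PSL2Z.mk_eq_mk).1 h with rfl | rfl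
          · rfl
          · simp
        simp only [cond_true, cond_false] at hg hg'
        lia
      rintro (_ | _) (_ | _) h
      · exact absurd rfl h
      · exact key
      · exact key.symm
      · exact absurd rfl h
    · rintro (_ | _) (_ | _) h ⟨x, hx⟩ hx1
      · exact absurd rfl h
      · have hx' : ρbar x = ρ a := by
          rw [factor_false_cases hx (fun h => hx1 (Subtype.ext h))]; rfl
        change ρbar x • pingPongSet true ⊆ pingPongSet false
        rw [hx', ρ_a]
        refine pingPong_mul _ fun g hg => ?_
        simp [-Matrix.SpecialLinearGroup.coe_mul, PSL2Z.sl_mul_apply] at hg ⊢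
        nlinarith
      · change ρbar x • pingPongSet false ⊆ pingPongSet true
        rcases factor_true_cases hx (fun h => hx1 (Subtype.ext h)) with rfl | rfl
        · have hx' : ρbar (u : B4S2 ⧸ N) = ρ u := rfl
          rw [hx', ρ_u]
          refine pingPong_mul _ fun g hg => ?_
          simp [-Matrix.SpecialLinearGroup.coe_mul, PSL2Z.sl_mul_apply] at hg ⊢
          nlinarith [mul_self_nonneg (g 0 0), mul_self_nonneg (g 1 0)]
        · have hx' : ρbar ((u : B4S2 ⧸ N) ^ 2) = ρ u ^ 2 := map_pow _ _ _
          rw [hx', ρ_u, ← map_pow, pow_two]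
          refine pingPong_mul _ fun g hg => ?_
          simp [-Matrix.SpecialLinearGroup.coe_mul, PSL2Z.sl_mul_apply] at hg ⊢
          nlinarith [mul_self_nonneg (g 0 0), mul_self_nonneg (g 1 0)]
      · exact absurd rfl h
  intro x y hxy
  obtain ⟨x, rfl⟩ := hsurj x
  obtain ⟨y, rfl⟩ := hsurj y
  rw [hinj hxy]

theorem ker_ρ : ρ.ker = N := by
  refine le_antisymm (fun b hb => ?_) N_le_ker
  rw [← QuotientGroup.eq_one_iff]
  exact ρbar_injective (hb.trans (map_one ρbar).symm)

end B4S2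

end Kernel

section FiniteQuotient

/-- The field with nine elements. -/
abbrev F9 : Type := QuadraticAlgebra (ZMod 3) (-1) 0

namespace B4S2

open PSL2Z

/-- The matrix over `F9` with given entries and determinant one. -/
def slNine (a b c d : F9) (h : a * d - b * c = 1) : Matrix.SpecialLinearGroup (Fin 2) F9 :=
  ⟨!![a, b; c, d], by rw [Matrix.det_fin_two_of, h]⟩

/-- Images of the generators of `B₄(S²)` in `SL(2, 9)`. -/
def slNineMatrix (i : Fin 3) : Matrix.SpecialLinearGroup (Fin 2) F9 :=
  ![slNine 0 ⟨0, 1⟩ ⟨0, 1⟩ ⟨0, 1⟩ (by decide), slNine 0 ⟨0, 2⟩ ⟨0, 2⟩ ⟨0, 1⟩ (by decide),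
    slNine ⟨0, 1⟩ ⟨0, 2⟩ ⟨0, 2⟩ 0 (by decide)] i

/-- The representation of `B₄(S²)` in `SL(2, 9)`; its image is the binary octahedral group. -/
def θ : B4S2 →* Matrix.SpecialLinearGroup (Fin 2) F9 :=
  lift slNineMatrix (by decide +kernel) (by decide +kernel) (by decide +kernel)
    (by decide +kernel)

theorem θ_σ (i : Fin 3) : θ (σ i) = slNineMatrix i := lift_σ ..

/-- The action of `B₄(S²)` on the symmetric group on three letters, as `SL(2, 2)`. -/
def τ : B4S2 →* Matrix.SpecialLinearGroup (Fin 2) (ZMod 2) := modTwo.comp ρ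

theorem τ_eq_one_of_mem {n : B4S2} (hn : n ∈ N) : τ n = 1 := by
  have : ρ n = 1 := N_le_ker hn
  rw [τ, MonoidHom.comp_apply, this, map_one]

/-- The image of `p` in `SL(2, 9)`. -/
def θp : Matrix.SpecialLinearGroup (Fin 2) F9 := slNineMatrix 0 * (slNineMatrix 2)⁻¹

/-- The image of `q` in `SL(2, 9)`. -/
def θq : Matrix.SpecialLinearGroup (Fin 2) F9 := slNineMatrix 1 * θp * (slNineMatrix 1)⁻¹

/-- The image of `a` in `SL(2, 9)`. -/
def θa : Matrix.SpecialLinearGroup (Fin 2) F9 :=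
  slNineMatrix 0 * slNineMatrix 1 * slNineMatrix 0

/-- The image of `u` in `SL(2, 9)`. -/
def θu : Matrix.SpecialLinearGroup (Fin 2) F9 := slNineMatrix 0 * slNineMatrix 1

/-- The image of `a` in `SL(2, 2)`. -/
def τa : Matrix.SpecialLinearGroup (Fin 2) (ZMod 2) := ⟨!![0, 1; 1, 0], by decide⟩

/-- The image of `u` in `SL(2, 2)`. -/
def τu : Matrix.SpecialLinearGroup (Fin 2) (ZMod 2) := ⟨!![0, 1; 1, 1], by decide⟩

theorem θ_p : θ p = θp := by simp only [p, map_mul, map_inv, θ_σ, θp]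

theorem θ_q : θ q = θq := by simp only [q, map_mul, map_inv, θ_σ, θ_p, θq]

theorem θ_a : θ a = θa := by simp only [a, map_mul, θ_σ, θa]

theorem θ_u : θ u = θu := by simp only [u, map_mul, θ_σ, θu]

theorem τ_a : τ a = τa := by
  rw [τ, MonoidHom.comp_apply, ρ_a]
  ext i j
  rw [modTwo_mk_apply]
  fin_cases i <;> fin_cases j <;> simp [τa]

theorem τ_u : τ u = τu := by
  rw [τ, MonoidHom.comp_apply, ρ_u]
  ext i j
  rw [modTwo_mk_apply]
  fin_cases i <;> fin_cases j <;> simp [τu]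

theorem ι_cases (x : QuaternionGroup 2) :
    ∃ (e : Fin 2) (k : Fin 4), ι x = q ^ (e : ℕ) * p ^ (k : ℕ) ∧ (e = 0 → k = 0 → x = 1) := by
  rcases x with j | j
  · have h : j = ((j.val : ℤ) : ZMod (2 * 2)) := by simp
    refine ⟨0, ⟨j.val, ZMod.val_lt j⟩, ?_, fun _ h0 => ?_⟩
    · nth_rw 1 [h]
      rw [ι, QuaternionGroup.lift_a, zpow_natCast, Fin.val_zero, pow_zero, one_mul]
    · rw [h, show j.val = 0 from congrArg Fin.val h0]
      rfl
  · have h : j = ((j.val : ℤ) : ZMod (2 * 2)) := by simp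
    refine ⟨1, ⟨j.val, ZMod.val_lt j⟩, ?_, fun h0 => absurd h0 (by decide)⟩
    nth_rw 1 [h]
    rw [ι, QuaternionGroup.lift_xa, zpow_natCast, Fin.val_one, pow_one]

theorem N_cases {n : B4S2} (hn : n ∈ N) :
    ∃ (e : Fin 2) (k : Fin 4), n = q ^ (e : ℕ) * p ^ (k : ℕ) := by
  obtain ⟨x, rfl⟩ := hn
  obtain ⟨e, k, h, -⟩ := ι_cases x
  exact ⟨e, k, h⟩

theorem θ_q_pow_mul_p_pow (e k : ℕ) : θ (q ^ e * p ^ k) = θq ^ e * θp ^ k := by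
  rw [map_mul, map_pow, map_pow, θ_q, θ_p]

theorem θq_pow_mul_θp_pow_eq_one :
    ∀ (e : Fin 2) (k : Fin 4), θq ^ (e : ℕ) * θp ^ (k : ℕ) = 1 → e = 0 ∧ k = 0 := by
  decide +kernel

theorem eq_one_of_θ_ι {x : QuaternionGroup 2} (h : θ (ι x) = 1) : x = 1 := by
  obtain ⟨e, k, h', hx⟩ := ι_cases x
  rw [h', θ_q_pow_mul_p_pow] at h
  obtain ⟨he, hk⟩ := θq_pow_mul_θp_pow_eq_one e k h
  exact hx he hk

theorem ι_injective : Function.Injective ι :=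
  (injective_iff_map_eq_one ι).2 fun x h => eq_one_of_θ_ι (by rw [h, map_one])

theorem eq_one_of_θ_eq_one_of_mem {n : B4S2} (hn : n ∈ N) (h : θ n = 1) : n = 1 := by
  obtain ⟨x, rfl⟩ := hn
  rw [eq_one_of_θ_ι h, map_one]

theorem eq_of_θ_eq_of_mem {m n : B4S2} (hmn : m * n⁻¹ ∈ N) (h : θ m = θ n) : m = n :=
  mul_inv_eq_one.1 (eq_one_of_θ_eq_one_of_mem hmn (by rw [map_mul, map_inv, h, mul_inv_cancel]))

/-- The subgroup of elements acting through `θ` and `τ` like an element of `N`. -/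
def K : Subgroup B4S2 := N ⊔ (θ.prod τ).ker

instance : K.Normal := Subgroup.sup_normal _ _

theorem mem_K {b : B4S2} : b ∈ K ↔ ∃ n ∈ N, θ n = θ b ∧ τ b = 1 := by
  rw [K, ← Subgroup.comap_map_eq, Subgroup.mem_comap, Subgroup.mem_map]
  refine exists_congr fun n => and_congr_right fun hn => ?_
  rw [MonoidHom.prod_apply, MonoidHom.prod_apply, Prod.mk.injEq, τ_eq_one_of_mem hn,
    eq_comm (a := 1)]

theorem exists_normal_form_mod_K (b : B4S2) :
    ∃ (i : Fin 2) (j : Fin 3), (a ^ (i : ℕ) * u ^ (j : ℕ))⁻¹ * b ∈ K := by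
  have ha : (a : B4S2 ⧸ K) ^ 2 = 1 := by
    rw [← QuotientGroup.mk_pow, QuotientGroup.eq_one_iff]
    exact Subgroup.mem_sup_left a_sq_mem
  have hu : (u : B4S2 ⧸ K) ^ 3 = 1 := by
    rw [← QuotientGroup.mk_pow, u_cube, QuotientGroup.eq_one_iff]
    exact Subgroup.mem_sup_left a_sq_mem
  have hua : (u : B4S2 ⧸ K) * a = a * (u : B4S2 ⧸ K) ^ 2 := by
    rw [← QuotientGroup.mk_pow, ← QuotientGroup.mk_mul, ← QuotientGroup.mk_mul, ← mul_inv_eq_one,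
      ← QuotientGroup.mk_inv, ← QuotientGroup.mk_mul, QuotientGroup.eq_one_iff, mem_K]
    refine ⟨p * q⁻¹, mul_mem p_mem (inv_mem q_mem), ?_, ?_⟩
    · simp only [map_mul, map_inv, map_pow, θ_p, θ_q, θ_a, θ_u]
      decide +kernel
    · simp only [map_mul, map_inv, map_pow, τ_a, τ_u]
      decide
  have hua' (i j : ℕ) : (u : B4S2 ⧸ K) ^ j * (a : B4S2 ⧸ K) ^ i =
      (a : B4S2 ⧸ K) ^ i * (u : B4S2 ⧸ K) ^ (2 ^ i * j) := by
    have h : SemiconjBy (a : B4S2 ⧸ K) ((u : B4S2 ⧸ K) ^ 2) u := hua.symm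
    have h' (i : ℕ) : ((u : B4S2 ⧸ K)) * (a : B4S2 ⧸ K) ^ i =
        (a : B4S2 ⧸ K) ^ i * (u : B4S2 ⧸ K) ^ (2 ^ i) := by
      induction i with
      | zero => simp
      | succ i ih =>
        rw [pow_succ (a : B4S2 ⧸ K), ← mul_assoc, ih, mul_assoc, ← (h.pow_right (2 ^ i)).eq,
          ← pow_mul, ← pow_succ', mul_assoc]
    have h'' : SemiconjBy ((a : B4S2 ⧸ K) ^ i) ((u : B4S2 ⧸ K) ^ 2 ^ i) u := (h' i).symm
    rw [← (h''.pow_right j).eq, ← pow_mul]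
  let S : Subgroup B4S2 :=
    { carrier := {b | ∃ i j : ℕ, (b : B4S2 ⧸ K) = (a : B4S2 ⧸ K) ^ i * (u : B4S2 ⧸ K) ^ j}
      one_mem' := ⟨0, 0, by simp⟩
      mul_mem' := by
        rintro x y ⟨i, j, hx⟩ ⟨k, l, hy⟩
        refine ⟨i + k, 2 ^ k * j + l, ?_⟩
        rw [QuotientGroup.mk_mul, hx, hy, mul_assoc, ← mul_assoc (_ ^ j), hua', pow_add, pow_add]
        simp only [mul_assoc]
      inv_mem' := by
        rintro x ⟨i, j, hx⟩
        refine ⟨i, 2 ^ i * (2 * j), ?_⟩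
        rw [QuotientGroup.mk_inv, hx, mul_inv_rev, ← hua']
        congr 1
        · rw [inv_eq_iff_mul_eq_one, ← pow_add, show j + 2 * j = 3 * j by lia, pow_mul, hu, one_pow]
        · rw [inv_eq_iff_mul_eq_one, ← pow_add, ← two_mul, pow_mul, ha, one_pow] }
  have hS : S = ⊤ := closure_insert_N
    (fun n hn => ⟨0, 0, by
      rw [pow_zero, pow_zero, mul_one, QuotientGroup.eq_one_iff]
      exact Subgroup.mem_sup_left hn⟩)
    ⟨1, 0, by simp⟩ ⟨0, 1, by simp⟩
  obtain ⟨i, j, h⟩ : b ∈ S := hS ▸ Subgroup.mem_top b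
  refine ⟨⟨i % 2, Nat.mod_lt _ two_pos⟩, ⟨j % 3, Nat.mod_lt _ three_pos⟩, ?_⟩
  rw [← QuotientGroup.eq, QuotientGroup.mk_mul, QuotientGroup.mk_pow, QuotientGroup.mk_pow, h,
    ← pow_eq_pow_mod i ha, ← pow_eq_pow_mod j hu]

theorem exists_normal_form (b : B4S2) :
    ∃ (i : Fin 2) (j : Fin 3) (e : Fin 2) (k : Fin 4),
      θ b = θa ^ (i : ℕ) * θu ^ (j : ℕ) * (θq ^ (e : ℕ) * θp ^ (k : ℕ)) ∧
      τ b = τa ^ (i : ℕ) * τu ^ (j : ℕ) := by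
  obtain ⟨i, j, h⟩ := exists_normal_form_mod_K b
  obtain ⟨n, hn, h1, h2⟩ := mem_K.1 h
  obtain ⟨e, k, rfl⟩ := N_cases hn
  refine ⟨i, j, e, k, ?_, ?_⟩
  · rw [← θ_q_pow_mul_p_pow, h1]
    simp only [map_mul, map_inv, map_pow, θ_a, θ_u, mul_inv_cancel_left]
  · rw [map_mul, map_inv, inv_mul_eq_one] at h2
    rw [← h2, map_mul, map_pow, map_pow, τ_a, τ_u]

theorem τ_eq_one_of_θ_eq_one {b : B4S2} (h : θ b = 1) : τ b = 1 := by
  have key : ∀ (i : Fin 2) (j : Fin 3) (e : Fin 2) (k : Fin 4),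
      θa ^ (i : ℕ) * θu ^ (j : ℕ) * (θq ^ (e : ℕ) * θp ^ (k : ℕ)) = 1 →
      τa ^ (i : ℕ) * τu ^ (j : ℕ) = 1 := by
    decide +kernel
  obtain ⟨i, j, e, k, h1, h2⟩ := exists_normal_form b
  rw [h2]
  exact key i j e k (h1 ▸ h)

theorem exists_θ_eq_of_τ_eq_one {b : B4S2} (h : τ b = 1) : ∃ n ∈ N, θ n = θ b := by
  have key : ∀ (i : Fin 2) (j : Fin 3), τa ^ (i : ℕ) * τu ^ (j : ℕ) = 1 → i = 0 ∧ j = 0 := by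
    decide +kernel
  obtain ⟨i, j, e, k, h1, h2⟩ := exists_normal_form b
  obtain ⟨rfl, rfl⟩ := key i j (h2 ▸ h)
  refine ⟨_, mul_mem (pow_mem q_mem e) (pow_mem p_mem k), ?_⟩
  rw [θ_q_pow_mul_p_pow, h1]
  simp

/-- The inclusion of `SL(2, 3)` in `SL(2, 9)`. -/
def slThreeHom :
    Matrix.SpecialLinearGroup (Fin 2) (ZMod 3) →* Matrix.SpecialLinearGroup (Fin 2) F9 :=
  Matrix.SpecialLinearGroup.map (algebraMap (ZMod 3) F9)

theorem slThreeHom_injective : Function.Injective slThreeHom := by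
  intro x y h
  ext i j
  have := congrArg (fun M : Matrix.SpecialLinearGroup (Fin 2) F9 => (M i j).re) h
  exact this

theorem θ_mem_range_slThreeHom {b : B4S2} (h : τ b ^ 3 = 1) : θ b ∈ slThreeHom.range := by
  have key : ∀ (i : Fin 2) (j : Fin 3), (τa ^ (i : ℕ) * τu ^ (j : ℕ)) ^ 3 = 1 → i = 0 := by
    decide +kernel
  have hu : θu ∈ slThreeHom.range := ⟨⟨!![1, 2; 1, 0], by decide⟩, by decide +kernel⟩
  have hp : θp ∈ slThreeHom.range := ⟨⟨!![2, 2; 2, 1], by decide⟩, by decide +kernel⟩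
  have hq : θq ∈ slThreeHom.range := ⟨⟨!![0, 2; 1, 0], by decide⟩, by decide +kernel⟩
  obtain ⟨i, j, e, k, h1, h2⟩ := exists_normal_form b
  obtain rfl := key i j (h2 ▸ h)
  rw [h1, Fin.val_zero, pow_zero, one_mul]
  exact mul_mem (pow_mem hu _) (mul_mem (pow_mem hq _) (pow_mem hp _))

theorem card_slThree : Nat.card (Matrix.SpecialLinearGroup (Fin 2) (ZMod 3)) = 24 := by
  have : Fintype.card {A : Matrix (Fin 2) (Fin 2) (ZMod 3) // A.det = 1} = 24 := by
    decide +kernel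
  rw [← this, ← Nat.card_eq_fintype_card]
  rfl

theorem mem_N_of_isOfFinOrder {b : B4S2} (hb : IsOfFinOrder b) (h : τ b = 1) : b ∈ N := by
  rw [← ker_ρ]
  exact eq_one_of_modTwo_eq_one (ρ.isOfFinOrder hb) h

theorem eq_one_of_isOfFinOrder {b : B4S2} (hb : IsOfFinOrder b) (h : θ b = 1) : b = 1 :=
  eq_one_of_θ_eq_one_of_mem (mem_N_of_isOfFinOrder hb (τ_eq_one_of_θ_eq_one h)) h

end B4S2

end FiniteQuotient

section GeneralizedQuaternion

namespace B4S2

open PSL2Z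

theorem isOfFinOrder_of_mem_N {n : B4S2} (hn : n ∈ N) : IsOfFinOrder n := by
  have h : IsOfFinOrder (⟨n, hn⟩ : N) := isOfFinOrder_of_finite _
  exact N.subtype.isOfFinOrder h

theorem sq_eq_one_cases {G : Type*} [Group G] {x : G} (hx : x ^ 2 = 1) {g : G}
    (hg : g ∈ Subgroup.zpowers x) : g = 1 ∨ g = x := by
  obtain ⟨k, rfl⟩ := hg
  rcases Int.even_or_odd' k with ⟨m, rfl | rfl⟩
  · left
    change x ^ (2 * m) = 1
    rw [zpow_mul, zpow_ofNat, hx, one_zpow]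
  · right
    change x ^ (2 * m + 1) = x
    rw [zpow_add, zpow_mul, zpow_ofNat, hx, one_zpow, one_mul, zpow_one]

theorem exists_quaternion_hom_of_θ_eq {y : B4S2} (hy : y ^ 2 ∈ N) (hθ : θ y = θ a) :
    ∃ f : QuaternionGroup 4 →* B4S2, Function.Injective f ∧ N ≤ f.range ∧ y ∈ f.range ∧
      ∀ g ∈ f.range, (g : B4S2 ⧸ N) ∈ Subgroup.zpowers (y : B4S2 ⧸ N) := by
  obtain ⟨α, hα⟩ : ∃ α, α = p * q⁻¹ * y := ⟨_, rfl⟩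
  have hpN : (p : B4S2 ⧸ N) = 1 := (QuotientGroup.eq_one_iff _).2 p_mem
  have hαy : (α : B4S2 ⧸ N) = y := by
    rw [hα, QuotientGroup.mk_mul,
      (QuotientGroup.eq_one_iff _).2 (mul_mem p_mem (inv_mem q_mem)), one_mul]
  have hα2 : α ^ 2 ∈ N := by
    rw [← QuotientGroup.eq_one_iff, QuotientGroup.mk_pow, hαy, ← QuotientGroup.mk_pow,
      QuotientGroup.eq_one_iff]
    exact hy
  have hα4 : α ^ 4 ∈ N := by
    have := pow_mem hα2 2
    rwa [← pow_mul] at this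
  have hα8 : α ^ 8 ∈ N := by
    have := pow_mem hα4 2
    rwa [← pow_mul] at this
  have θα : θ α = θp * θq⁻¹ * θa := by
    rw [hα, map_mul, map_mul, map_inv, θ_p, θ_q, hθ, θ_a]
  have h1 : α ^ (2 * 4) = 1 := eq_one_of_θ_eq_one_of_mem hα8 (by
    rw [map_pow, θα]
    decide +kernel)
  have h2 : p ^ 2 = α ^ 4 :=
    eq_of_θ_eq_of_mem (mul_mem (pow_mem p_mem 2) (inv_mem hα4)) (by
      rw [map_pow, map_pow, θα, θ_p]
      decide +kernel)
  have h3 : α * p = p * α⁻¹ := by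
    refine eq_of_θ_eq_of_mem ?_ ?_
    · rw [← QuotientGroup.eq_one_iff] at hα2 ⊢
      rw [mul_inv_rev, inv_inv]
      simp only [QuotientGroup.mk_mul, QuotientGroup.mk_inv, hpN, inv_one, mul_one]
      rwa [pow_two] at hα2
    · rw [map_mul, map_mul, map_inv, θα, θ_p]
      decide +kernel
  have h4 : α ^ 2 = q⁻¹ :=
    eq_of_θ_eq_of_mem (mul_mem hα2 (inv_mem (inv_mem q_mem))) (by
      rw [map_pow, map_inv, θα, θ_q]
      decide +kernel)
  have hrange := QuaternionGroup.lift_range h1 h2 h3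
  have hαr : α ∈ (QuaternionGroup.lift h1 h2 h3).range :=
    hrange ▸ Subgroup.subset_closure (by simp)
  have hpr : p ∈ (QuaternionGroup.lift h1 h2 h3).range :=
    hrange ▸ Subgroup.subset_closure (by simp)
  have hqr : q ∈ (QuaternionGroup.lift h1 h2 h3).range := by
    rw [← inv_inv q, ← h4]
    exact inv_mem (pow_mem hαr 2)
  refine ⟨QuaternionGroup.lift h1 h2 h3, ?_, ?_, ?_, ?_⟩
  · have key1 : ∀ k : Fin 8, (θp * θq⁻¹ * θa) ^ (k : ℕ) = 1 → k = 0 := by decide +kernel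
    have key2 : ∀ k : Fin 8, θp * (θp * θq⁻¹ * θa) ^ (k : ℕ) ≠ 1 := by decide +kernel
    refine (injective_iff_map_eq_one _).2 fun x hx => ?_
    replace hx := congrArg θ hx
    rw [map_one] at hx
    rcases x with j | j
    · have h : j = ((j.val : ℤ) : ZMod (2 * 4)) := by simp
      rw [h, QuaternionGroup.lift_a, zpow_natCast, map_pow, θα] at hx
      have h0 : j.val = 0 := congrArg Fin.val (key1 ⟨j.val, ZMod.val_lt j⟩ hx)
      rw [h, h0]
      rfl
    · have h : j = ((j.val : ℤ) : ZMod (2 * 4)) := by simp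
      rw [h, QuaternionGroup.lift_xa, zpow_natCast, map_mul, map_pow, θα, θ_p] at hx
      exact absurd hx (key2 ⟨j.val, ZMod.val_lt j⟩)
  · rw [N_eq, Subgroup.closure_le]
    rintro _ (rfl | rfl)
    · exact hpr
    · exact hqr
  · have : y = (p * q⁻¹)⁻¹ * α := by rw [hα, inv_mul_cancel_left]
    rw [this]
    exact mul_mem (inv_mem (mul_mem hpr (inv_mem hqr))) hαr
  · have h : (QuaternionGroup.lift h1 h2 h3).range ≤
        (Subgroup.zpowers (y : B4S2 ⧸ N)).comap (QuotientGroup.mk' N) := by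
      rw [hrange, Subgroup.closure_le]
      rintro _ (rfl | rfl)
      · exact hαy ▸ Subgroup.mem_zpowers _
      · change (p : B4S2 ⧸ N) ∈ Subgroup.zpowers (y : B4S2 ⧸ N)
        rw [hpN]
        exact one_mem _
    exact fun g hg => h hg

theorem sl_two_conj : ∀ t : Matrix.SpecialLinearGroup (Fin 2) (ZMod 2),
    t ≠ 1 ∧ t ^ 2 = 1 → ∃ j : Fin 3, τu ^ (j : ℕ) * t * (τu ^ (j : ℕ))⁻¹ = τa := by
  decide +kernel

theorem exists_quaternion_hom {x : B4S2} (hx : x ^ 2 ∈ N) (hxN : x ∉ N) :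
    ∃ f : QuaternionGroup 4 →* B4S2, Function.Injective f ∧ N ≤ f.range ∧ x ∈ f.range ∧
      ∀ g ∈ f.range, g ∈ N ∨ g * x⁻¹ ∈ N := by
  have hfin : IsOfFinOrder x := (isOfFinOrder_of_mem_N hx).of_pow two_ne_zero
  have hτ : τ x ≠ 1 := fun h => hxN (mem_N_of_isOfFinOrder hfin h)
  obtain ⟨j, hj⟩ := sl_two_conj (τ x) ⟨hτ, by rw [← map_pow, τ_eq_one_of_mem hx]⟩
  set b := u ^ (j : ℕ) with hb
  have hτ' : τ (b * x * b⁻¹ * a⁻¹) = 1 := by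
    rw [map_mul, map_inv, τ_a, ← hj, hb]
    simp only [map_mul, map_pow, map_inv, τ_u, mul_inv_cancel]
  obtain ⟨n, hn, hθ⟩ := exists_θ_eq_of_τ_eq_one hτ'
  have hn1 : (n : B4S2 ⧸ N) = 1 := (QuotientGroup.eq_one_iff _).2 hn
  have hx2 : (x : B4S2 ⧸ N) ^ 2 = 1 := by
    rw [← QuotientGroup.mk_pow, QuotientGroup.eq_one_iff]
    exact hx
  obtain ⟨f, hf, hN, hy, hr⟩ := exists_quaternion_hom_of_θ_eq (y := n⁻¹ * (b * x * b⁻¹))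
    (by
      rw [← QuotientGroup.eq_one_iff]
      simp only [QuotientGroup.mk_mul, QuotientGroup.mk_inv, QuotientGroup.mk_pow, hn1, inv_one,
        one_mul, conj_pow, hx2, mul_one, mul_inv_cancel])
    (by rw [map_mul, map_inv, hθ, map_mul _ _ a⁻¹, map_inv θ a]; group)
  refine ⟨(MulAut.conj b⁻¹).toMonoidHom.comp f, (MulAut.conj b⁻¹).injective.comp hf, ?_, ?_, ?_⟩
  · intro m hm
    obtain ⟨z, hz⟩ := hN (Subgroup.Normal.conj_mem inferInstance m hm b)
    refine ⟨z, ?_⟩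
    simp only [MonoidHom.comp_apply, hz, MulEquiv.coe_toMonoidHom, MulAut.conj_apply]
    group
  · obtain ⟨z, hz⟩ := mul_mem (hN hn) hy
    refine ⟨z, ?_⟩
    simp only [MonoidHom.comp_apply, hz, MulEquiv.coe_toMonoidHom, MulAut.conj_apply]
    group
  · rintro _ ⟨z, rfl⟩
    have hy2 : (x : B4S2 ⧸ N) ^ 2 = 1 := hx2
    have h := hr (f z) ⟨z, rfl⟩
    simp only [QuotientGroup.mk_mul, QuotientGroup.mk_inv, hn1, inv_one, one_mul] at h
    simp only [MonoidHom.comp_apply, MulEquiv.coe_toMonoidHom, MulAut.conj_apply,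
      ← QuotientGroup.eq_one_iff (N := N), QuotientGroup.mk_mul, QuotientGroup.mk_inv]
    rcases sq_eq_one_cases (by rw [conj_pow, hx2, mul_one, mul_inv_cancel]) h with h | h
    · left
      rw [h]
      group
    · right
      rw [h]
      group

end B4S2

end GeneralizedQuaternion

section Extensions

open Monoid

variable {G H Q A : Type*} [Group G] [Group H] [Group Q] [Group A]

theorem exists_mulEquiv_semidirectProduct {i : Q →* G} (hi : Function.Injective i) {π : G →* H}
    (hπ : π.ker = i.range) {c : G} (hc : ¬IsOfFinOrder (π c))
    (hG : ∀ g, π g ∈ Subgroup.zpowers (π c)) :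
    ∃ φ : Multiplicative ℤ →* MulAut Q,
      Nonempty (G ≃* SemidirectProduct Q (Multiplicative ℤ) φ) := by
  have hn : i.range.Normal := hπ ▸ inferInstance
  let e : Q ≃* i.range := MonoidHom.ofInjective hi
  let κ : G →* MulAut Q := (MulAut.congr e.symm).toMonoidHom.comp MulAut.conjNormal
  have hκ : ∀ g n, i (κ g n) = g * i n * g⁻¹ := fun g n => by
    have h1 : ∀ m, i m = (e m : G) := fun m => rfl
    have h2 : e (κ g n) = MulAut.conjNormal g (e n) := e.apply_symm_apply _
    rw [h1, h2, MulAut.conjNormal_apply, h1]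
  let φ : Multiplicative ℤ →* MulAut Q := κ.comp (zpowersHom G c)
  let F : SemidirectProduct Q (Multiplicative ℤ) φ →* G :=
    SemidirectProduct.lift i (zpowersHom G c) fun k => by
      ext n
      exact hκ _ n
  have hF : ∀ x, F x = i x.left * c ^ (Multiplicative.toAdd x.right) := fun x => rfl
  have hπi : ∀ n, π (i n) = 1 := fun n => by
    rw [← MonoidHom.mem_ker, hπ]
    exact ⟨n, rfl⟩
  refine ⟨φ, ⟨(MulEquiv.ofBijective F ⟨(injective_iff_map_eq_one _).2 fun x hx => ?_,
    fun g => ?_⟩).symm⟩⟩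
  · rw [hF] at hx
    have h := congrArg π hx
    rw [map_mul, hπi, one_mul, map_zpow, map_one] at h
    have h0 : Multiplicative.toAdd x.right = 0 :=
      zpow_injective_of_not_isOfFinOrder hc (by simpa using h)
    rw [h0, zpow_zero, mul_one] at hx
    ext
    · exact (injective_iff_map_eq_one _).1 hi _ hx
    · exact h0
  · obtain ⟨k, hk⟩ := hG g
    obtain ⟨n, hn⟩ : g * c ^ (-k) ∈ i.range := by
      rw [← hπ, MonoidHom.mem_ker, map_mul, map_zpow, zpow_neg, ← hk]
      exact mul_inv_cancel _
    refine ⟨⟨n, Multiplicative.ofAdd k⟩, ?_⟩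
    rw [hF]
    simp [hn]

theorem exists_mulEquiv_pushoutI {i : Q →* G} (hi : Function.Injective i) {π : G →* H}
    (hπ : π.ker = i.range) {f : Bool → A →* G} (hf : ∀ b, Function.Injective (f b))
    (hif : ∀ b, i.range ≤ (f b).range) {x : Bool → A} (hx : ∀ b, f b (x b) ^ 2 ∈ i.range)
    (hxf : ∀ b y, f b y ∈ i.range ∨ f b y * (f b (x b))⁻¹ ∈ i.range)
    (hG : ⨆ b, (f b).range = ⊤)
    (hinf : ¬IsOfFinOrder (π (f true (x true)) * π (f false (x false))))
    (hx1 : π (f true (x true)) ∉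
      Subgroup.zpowers (π (f true (x true)) * π (f false (x false)))) :
    ∃ j : Bool → Q →* A, (∀ b, Function.Injective (j b)) ∧ Nonempty (G ≃* PushoutI j) := by
  have hn : i.range.Normal := hπ ▸ inferInstance
  choose j hj using fun b => show ∃ j : Q →* A, (f b).comp j = i from
    ⟨(MonoidHom.ofInjective (hf b)).symm.toMonoidHom.comp
      (i.codRestrict (f b).range fun n => hif b ⟨n, rfl⟩), by
      ext n
      exact congrArg Subtype.val ((MonoidHom.ofInjective (hf b)).apply_symm_apply _)⟩
  have hj' : ∀ b n, f b (j b n) = i n := fun b n => DFunLike.congr_fun (hj b) n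
  refine ⟨j, fun b => Function.Injective.of_comp (f := f b) ?_, ?_⟩
  · rw [← MonoidHom.coe_comp, hj]
    exact hi
  let F : PushoutI j →* G := PushoutI.lift f i hj
  have hFof : ∀ b y, F (PushoutI.of b y) = f b y := fun b y => by simp [F]
  have hFbase : ∀ n, F (PushoutI.base j n) = i n := fun n => by simp [F]
  have hbase : ∀ b y, f b y ∈ i.range → PushoutI.of b y ∈ (PushoutI.base j).range := by
    rintro b y ⟨n, hn⟩
    rw [← hj' b] at hn
    exact ⟨n, by rw [← hf b hn, PushoutI.of_apply_eq_base]⟩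
  have hN : (PushoutI.base j).range.Normal := by
    refine ⟨fun m hm g => ?_⟩
    induction g using PushoutI.induction_on generalizing m with
    | of b y =>
      obtain ⟨n, rfl⟩ := hm
      rw [← PushoutI.of_apply_eq_base j b, ← map_inv, ← map_mul, ← map_mul]
      refine hbase _ _ ?_
      rw [map_mul, map_mul, hj', map_inv]
      exact hn.conj_mem _ ⟨n, rfl⟩ _
    | base n =>
      have hn : PushoutI.base j n ∈ (PushoutI.base j).range := ⟨n, rfl⟩
      exact mul_mem (mul_mem hn hm) (inv_mem hn)
    | mul g h hg hh =>
      have := hg _ (hh _ hm)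
      simpa only [mul_inv_rev, mul_assoc] using this
  let X : Bool → PushoutI j ⧸ (PushoutI.base j).range := fun b => (PushoutI.of b (x b) : PushoutI j)
  have hX : ∀ b, X b ^ 2 = 1 := fun b => by
    refine (QuotientGroup.eq_one_iff (N := (PushoutI.base j).range)
      (PushoutI.of b (x b) ^ 2)).2 ?_
    rw [← map_pow]
    exact hbase _ _ (by rw [map_pow]; exact hx b)
  have hgen : Subgroup.closure {X true, X false} = ⊤ := by
    have hXm : ∀ b, X b ∈ Subgroup.closure {X true, X false} := by
      rintro (_ | _) <;> exact Subgroup.subset_closure (by simp)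
    refine eq_top_iff.2 fun z _ => ?_
    obtain ⟨g, rfl⟩ := QuotientGroup.mk_surjective z
    induction g using PushoutI.induction_on with
    | of b y =>
      rcases hxf b y with h | h
      · rw [(QuotientGroup.eq_one_iff _).2 (hbase _ _ h)]
        exact one_mem _
      · rw [← map_inv, ← map_mul] at h
        have h := (QuotientGroup.eq_one_iff _).2 (hbase _ _ h)
        rw [map_mul, map_inv, QuotientGroup.mk_mul, QuotientGroup.mk_inv, mul_inv_eq_one] at h
        rw [h]
        exact hXm b
    | base n =>
      rw [(QuotientGroup.eq_one_iff (N := (PushoutI.base j).range) _).2 ⟨n, rfl⟩]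
      exact one_mem _
    | mul g h hg hh => exact mul_mem (hg trivial) (hh trivial)
  have hπi : ∀ n, π (i n) = 1 := fun n => by
    rw [← MonoidHom.mem_ker, hπ]
    exact ⟨n, rfl⟩
  let ψ : PushoutI j ⧸ (PushoutI.base j).range →* H :=
    QuotientGroup.lift _ (π.comp F) (by
      rintro _ ⟨n, rfl⟩
      rw [MonoidHom.mem_ker, MonoidHom.comp_apply, hFbase, hπi])
  have hψ : ∀ g : PushoutI j, ψ g = π (F g) := fun g => rfl
  have hψX : ∀ b, ψ (X b) = π (f b (x b)) := fun b => by rw [hψ, hFof]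
  refine ⟨(MulEquiv.ofBijective F ⟨(injective_iff_map_eq_one _).2 fun g hg => ?_, ?_⟩).symm⟩
  · have hg1 : ψ g = 1 := by rw [hψ, hg, map_one]
    have hg2 : (g : PushoutI j ⧸ (PushoutI.base j).range) = 1 := by
      obtain ⟨k, h | h⟩ := exists_zpow_mul_of_sq_eq_one (hX true) (hX false) hgen g
      · rw [h, map_zpow, map_mul, hψX, hψX] at hg1
        have hk : k = 0 := zpow_injective_of_not_isOfFinOrder hinf (by simpa using hg1)
        rw [h, hk, zpow_zero]
      · rw [h, map_mul, map_zpow, map_mul, hψX, hψX] at hg1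
        refine absurd ?_ hx1
        rw [Subgroup.mem_zpowers_iff]
        exact ⟨-k, by rw [zpow_neg, ← eq_inv_of_mul_eq_one_left hg1]⟩
    obtain ⟨n, rfl⟩ := (QuotientGroup.eq_one_iff _).1 hg2
    rw [hFbase] at hg
    rw [(injective_iff_map_eq_one _).1 hi _ hg, map_one]
  · rw [← MonoidHom.range_eq_top, eq_top_iff, ← hG, iSup_le_iff]
    rintro b _ ⟨y, rfl⟩
    exact ⟨PushoutI.of b y, hFof b y⟩

end Extensions

section MaximalSubgroups

namespace B4S2

open PSL2Z

theorem mem_ker_subgroupMap_ρ {K : Subgroup B4S2} {g : K} :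
    g ∈ (ρ.subgroupMap K).ker ↔ (g : B4S2) ∈ N := by
  rw [← ker_ρ, MonoidHom.mem_ker, MonoidHom.mem_ker, Subtype.ext_iff]
  rfl

theorem finite_ker_subgroupMap_ρ (K : Subgroup B4S2) :
    ((ρ.subgroupMap K).ker : Set K).Finite := by
  have hN : (N : Set B4S2).Finite := Set.finite_coe_iff.1 (inferInstanceAs (Finite N))
  refine (hN.preimage Subtype.val_injective.injOn).subset fun g hg => ?_
  exact mem_ker_subgroupMap_ρ.1 hg

theorem isVirtuallyCyclic_of_map_ρ {K : Subgroup B4S2} (h : IsVirtuallyCyclic (K.map ρ)) :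
    IsVirtuallyCyclic K :=
  h.of_finite_ker (ρ.subgroupMap K) (ρ.subgroupMap_surjective K) (finite_ker_subgroupMap_ρ K)

theorem map_ρ_N : N.map ρ = ⊥ :=
  (Subgroup.map_eq_bot_iff _).2 N_le_ker

theorem N_le_of_isMaximalVirtuallyCyclic {G : Subgroup B4S2} (hG : IsMaximalVirtuallyCyclic G) :
    N ≤ G := by
  have h : IsVirtuallyCyclic (N ⊔ G : Subgroup B4S2) := by
    refine isVirtuallyCyclic_of_map_ρ ?_
    rw [Subgroup.map_sup, map_ρ_N, bot_sup_eq]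
    exact hG.1.of_surjective (ρ.subgroupMap G) (ρ.subgroupMap_surjective G)
  exact hG.2 _ h le_sup_right ▸ le_sup_left

theorem isVirtuallyCyclic_sup_closure {x y : B4S2} (hx : x ^ 2 ∈ N) (hy : y ^ 2 ∈ N) :
    IsVirtuallyCyclic (N ⊔ Subgroup.closure {x, y} : Subgroup B4S2) := by
  refine isVirtuallyCyclic_of_map_ρ ?_
  rw [Subgroup.map_sup, map_ρ_N, bot_sup_eq, MonoidHom.map_closure, Set.image_pair]
  rw [← ker_ρ, MonoidHom.mem_ker, map_pow] at hx hy
  refine isVirtuallyCyclic_of_sq_eq_one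
    (x := ⟨ρ x, Subgroup.subset_closure (by simp)⟩)
    (y := ⟨ρ y, Subgroup.subset_closure (by simp)⟩)
    (Subtype.ext hx) (Subtype.ext hy) ?_
  rw [← Subgroup.closure_closure_coe_preimage (k := {ρ x, ρ y})]
  congr 1
  ext z
  simp [Subtype.ext_iff]

theorem card_N : Nat.card N = 8 := by
  rw [N, ← Nat.card_congr (MonoidHom.ofInjective ι_injective).toEquiv, Nat.card_eq_fintype_card,
    QuaternionGroup.card]

theorem sl_two_sq_eq : ∀ x y : Matrix.SpecialLinearGroup (Fin 2) (ZMod 2),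
    x ^ 2 = 1 ∧ y ^ 2 = 1 ∧ (x * y) ^ 2 = 1 → x ≠ 1 → y ≠ 1 → x = y := by
  decide +kernel

theorem nonempty_mulEquiv_slThree {G : Subgroup B4S2} [Finite G] (hN : N ≤ G) {g : B4S2}
    (hg : g ∈ G) (hg2 : τ g ^ 2 ≠ 1) :
    Nonempty (G ≃* Matrix.SpecialLinearGroup (Fin 2) (ZMod 3)) := by
  have hfin : ∀ h ∈ G, IsOfFinOrder h := fun h hh =>
    G.subtype.isOfFinOrder (isOfFinOrder_of_finite (⟨h, hh⟩ : G))
  have hg3 : τ g ^ 3 = 1 := (sl2_two_cases (τ g)).elim And.left fun h => absurd h.1 hg2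
  have hg1 : τ g ≠ 1 := fun h => hg2 (by rw [h, one_pow])
  have hcube : ∀ h ∈ G, τ h ^ 3 = 1 := fun h hh => by
    by_contra h3
    refine not_sq_and_cube (x := ρ h) (y := ρ g) (ρ.isOfFinOrder (hfin h hh))
      (ρ.isOfFinOrder (hfin g hg)) ?_ (fun h1 => h3 ?_)
      ((sl2_two_cases (τ h)).elim (fun h' => absurd h'.1 h3) And.left) hg1 hg3
    · rw [← map_mul]
      exact ρ.isOfFinOrder (hfin _ (mul_mem hh hg))
    · rw [show τ h = 1 from h1, one_pow]
  let f : G →* slThreeHom.range :=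
    (θ.comp G.subtype).codRestrict _ fun h => θ_mem_range_slThreeHom (hcube h h.2)
  have hf : Function.Injective f := (injective_iff_map_eq_one _).2 fun h hh =>
    Subtype.ext (eq_one_of_isOfFinOrder (hfin h h.2) (congrArg Subtype.val hh))
  let F : G →* Matrix.SpecialLinearGroup (Fin 2) (ZMod 3) :=
    (MonoidHom.ofInjective slThreeHom_injective).symm.toMonoidHom.comp f
  have hF : Function.Injective F :=
    (MonoidHom.ofInjective slThreeHom_injective).symm.injective.comp hf
  have h8 : 8 ∣ Nat.card G := card_N ▸ Subgroup.card_dvd_of_le hN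
  have h3 : 3 ∣ Nat.card G := by
    have h := orderOf_map_dvd (τ.comp G.subtype) ⟨g, hg⟩
    rw [show τ.comp G.subtype ⟨g, hg⟩ = τ g from rfl, orderOf_eq_prime hg3 hg1] at h
    exact h.trans (orderOf_dvd_natCard _)
  have hcard : Nat.card G = 24 := by
    refine Nat.dvd_antisymm (card_slThree ▸ Subgroup.card_dvd_of_injective F hF) ?_
    exact Nat.Coprime.mul_dvd_of_dvd_of_dvd (by norm_num : Nat.Coprime 8 3) h8 h3
  exact ⟨MulEquiv.ofBijective F
    ((Nat.bijective_iff_injective_and_card F).2 ⟨hF, by rw [hcard, card_slThree]⟩)⟩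

theorem exists_τ_sq_ne_one {G : Subgroup B4S2} (hG : IsMaximalVirtuallyCyclic G) [Finite G] :
    ∃ g ∈ G, τ g ^ 2 ≠ 1 := by
  by_contra! h
  have hN := N_le_of_isMaximalVirtuallyCyclic hG
  have hmem : ∀ g ∈ G, τ g = 1 → g ∈ N := fun g hg =>
    mem_N_of_isOfFinOrder (G.subtype.isOfFinOrder (isOfFinOrder_of_finite (⟨g, hg⟩ : G)))
  obtain ⟨x, hx, hxN, hxG⟩ : ∃ x ∈ G, x ^ 2 ∈ N ∧ ∀ g ∈ G, g ∈ N ∨ g * x⁻¹ ∈ N := by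
    by_cases hGN : ∀ g ∈ G, g ∈ N
    · exact ⟨1, one_mem _, by simp, fun g hg => .inl (hGN g hg)⟩
    push Not at hGN
    obtain ⟨x, hx, hxN⟩ := hGN
    refine ⟨x, hx, hmem _ (pow_mem hx 2) (by rw [map_pow, h x hx]), fun g hg => ?_⟩
    by_cases hgN : g ∈ N
    · exact .inl hgN
    refine .inr (hmem _ (mul_mem hg (inv_mem hx)) ?_)
    rw [map_mul, map_inv, mul_inv_eq_one]
    refine sl_two_sq_eq _ _ ⟨h g hg, h x hx, ?_⟩ (fun h1 => hgN (hmem g hg h1))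
      fun h1 => hxN (hmem x hx h1)
    rw [← map_mul]
    exact h _ (mul_mem hg hx)
  have key : ∀ y, y ^ 2 ∈ N → y ∈ G := fun y hy => by
    have hle : G ≤ N ⊔ Subgroup.closure {x, y} := fun g hg => by
      rcases hxG g hg with hg | hg
      · exact Subgroup.mem_sup_left hg
      · rw [← inv_mul_cancel_right g x]
        exact mul_mem (Subgroup.mem_sup_left hg)
          (Subgroup.mem_sup_right (Subgroup.subset_closure (by simp)))
    exact hG.2 _ (isVirtuallyCyclic_sup_closure hxN hy) hle ▸
      Subgroup.mem_sup_right (Subgroup.subset_closure (by simp))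
  have ha := key a a_sq_mem
  have hb := key (u * a * u⁻¹) (by
    rw [conj_pow]
    exact Subgroup.Normal.conj_mem inferInstance _ a_sq_mem u)
  have hab := h _ (mul_mem ha hb)
  rw [map_mul, map_mul, map_mul, map_inv, τ_a, τ_u] at hab
  revert hab
  decide +kernel

theorem semidirect_or_pushout_of_infinite {G : Subgroup B4S2} [Infinite G]
    (hG : IsVirtuallyCyclic G) (hN : N ≤ G) :
    (∃ φ : Multiplicative ℤ →* MulAut (QuaternionGroup 2),
      Nonempty (G ≃* SemidirectProduct (QuaternionGroup 2) (Multiplicative ℤ) φ)) ∨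
    ∃ j : Bool → QuaternionGroup 2 →* QuaternionGroup 4,
      (∀ b, Function.Injective (j b)) ∧ Nonempty (G ≃* Monoid.PushoutI j) := by
  let π := ρ.subgroupMap G
  have hπs : Function.Surjective π := ρ.subgroupMap_surjective G
  let i : QuaternionGroup 2 →* G := ι.codRestrict G fun n => hN ⟨n, rfl⟩
  have hi : Function.Injective i := fun m n h => ι_injective (congrArg Subtype.val h)
  have hir : ∀ g : G, g ∈ i.range ↔ (g : B4S2) ∈ N := fun g =>
    exists_congr fun n => Subtype.ext_iff
  have hπ : π.ker = i.range := by
    ext g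
    rw [mem_ker_subgroupMap_ρ, hir]
  have hπN : ∀ g : G, π g = 1 ↔ (g : B4S2) ∈ N := fun g => mem_ker_subgroupMap_ρ
  have hinf : Infinite (G.map ρ) := by
    refine not_finite_iff_infinite.1 fun hfin => ?_
    have : Finite π.ker := finite_ker_subgroupMap_ρ G
    exact not_finite_iff_infinite.2 ‹Infinite G›
      (π.finite_iff_finite_ker_range.2 ⟨this, inferInstance⟩)
  obtain ⟨c, hc, h⟩ := (hG.of_surjective π hπs).exists_zpowers fun x y hx hxf hxy => by
    rw [← Submonoid.isOfFinOrder_coe] at hxf ⊢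
    exact isOfFinOrder_of_commute_mk (fun h => hx (Subtype.ext h)) hxf (congrArg Subtype.val hxy)
  rcases h with h | ⟨x, hxc, hx2, hxcx, h⟩
  · left
    obtain ⟨c, rfl⟩ := hπs c
    exact exists_mulEquiv_semidirectProduct hi hπ hc fun g => h _
  right
  obtain ⟨y, hy⟩ : ∃ y : Bool → G.map ρ, y = fun b => bif b then x else x * c := ⟨_, rfl⟩
  have hy2 : ∀ b, y b ^ 2 = 1 := by
    rw [hy]
    rintro (_ | _)
    · have hxi : x⁻¹ = x := inv_eq_of_mul_eq_one_right (by rwa [← pow_two])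
      rw [hxi] at hxcx
      change (x * c) ^ 2 = 1
      rw [pow_two, ← mul_assoc, hxcx, inv_mul_cancel]
    · exact hx2
  have hy1 : ∀ b, y b ≠ 1 := by
    rw [hy]
    rintro (_ | _) h1
    · exact hxc (eq_inv_of_mul_eq_one_left h1 ▸ inv_mem (Subgroup.mem_zpowers c))
    · have hx1 : x = 1 := h1
      exact hxc (hx1 ▸ one_mem _)
  have hyc : y true * y false = c := by
    rw [hy]
    change x * (x * c) = c
    rw [← mul_assoc, ← pow_two, hx2, one_mul]
  choose z hz using fun b => hπs (y b)
  have hz2 : ∀ b, (z b : B4S2) ^ 2 ∈ N := fun b => by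
    rw [← Subgroup.coe_pow, ← hπN, map_pow, hz, hy2]
  choose f hf hfN hfz hfr using fun b =>
    exists_quaternion_hom (hz2 b) fun h => hy1 b (by rw [← hz, hπN]; exact h)
  have hfG : ∀ b w, f b w ∈ G := fun b w => by
    rcases hfr b _ ⟨w, rfl⟩ with h | h
    · exact hN h
    · simpa using mul_mem (hN h) (z b).2
  let f' : Bool → QuaternionGroup 4 →* G := fun b => (f b).codRestrict G (hfG b)
  have hif : ∀ b, i.range ≤ (f' b).range := by
    rintro b g hg
    obtain ⟨w, hw⟩ := hfN b ((hir g).1 hg)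
    exact ⟨w, Subtype.ext hw⟩
  choose w hw using hfz
  have hw' : ∀ b, f' b (w b) = z b := fun b => Subtype.ext (hw b)
  refine exists_mulEquiv_pushoutI hi hπ (f := f') (x := w)
    (fun b m n h => hf b (congrArg Subtype.val h)) hif (fun b => ?_) (fun b v => ?_) ?_ ?_ ?_
  · rw [hw', hir]
    exact hz2 b
  · rw [hw', hir, hir]
    exact hfr b _ ⟨v, rfl⟩
  · have hmem : ∀ b, z b ∈ ⨆ b, (f' b).range := fun b =>
      Subgroup.mem_iSup_of_mem b ⟨w b, hw' b⟩
    have hker : ∀ g, π g = 1 → g ∈ ⨆ b, (f' b).range := fun g hg =>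
      Subgroup.mem_iSup_of_mem true (hif true (hπ ▸ hg))
    have hpow : ∀ g, π g ∈ Subgroup.zpowers c → g ∈ ⨆ b, (f' b).range := by
      rintro g ⟨k, hk⟩
      rw [← inv_mul_cancel_right g ((z true * z false) ^ k)]
      refine mul_mem (hker _ ?_) (zpow_mem (mul_mem (hmem _) (hmem _)) k)
      rw [map_mul, map_inv, map_zpow, map_mul, hz, hz, hyc, ← hk]
      exact mul_inv_cancel _
    refine eq_top_iff.2 fun g _ => ?_
    rcases h (π g) with h | h
    · exact hpow g h
    · rw [← mul_inv_cancel_right g (z true)]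
      refine mul_mem (hpow _ ?_) (inv_mem (hmem true))
      rw [map_mul, hz, hy]
      exact h
  · rw [hw', hw', hz, hz, hyc]
    exact hc
  · rw [hw', hw', hz, hz, hyc, hy]
    exact hxc

end B4S2

end MaximalSubgroups

/-- Every maximal virtually cyclic subgroup of `B₄(S²)` is isomorphic to
the binary tetrahedral group `T* = SL(2, ℤ/3)`, or to a semidirect product `Q₈ ⋊ ℤ`, or to
an amalgamated free product `Q₁₆ *_{Q₈} Q₁₆`. -/
theorem maximal_virtuallyCyclic_subgroups_of_b4S2 (G : Subgroup B4S2)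
    (hG : IsMaximalVirtuallyCyclic G) :
    Nonempty (G ≃* Matrix.SpecialLinearGroup (Fin 2) (ZMod 3)) ∨
    (∃ φ : Multiplicative ℤ →* MulAut (QuaternionGroup 2),
      Nonempty (G ≃* SemidirectProduct (QuaternionGroup 2) (Multiplicative ℤ) φ)) ∨
    (∃ j₁ j₂ : QuaternionGroup 2 →* QuaternionGroup 4,
      Function.Injective j₁ ∧ Function.Injective j₂ ∧
      Nonempty (G ≃* Monoid.PushoutI
        (fun b : Bool => (bif b then j₁ else j₂ :
          QuaternionGroup 2 →* QuaternionGroup 4)))) := by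
  have hN := B4S2.N_le_of_isMaximalVirtuallyCyclic hG
  rcases finite_or_infinite G with _ | _
  · obtain ⟨g, hg, hg2⟩ := B4S2.exists_τ_sq_ne_one hG
    exact .inl (B4S2.nonempty_mulEquiv_slThree hN hg hg2)
  · refine .inr ((B4S2.semidirect_or_pushout_of_infinite hG.1 hN).imp_right ?_)
    rintro ⟨j, hj, e⟩
    have h : (fun b : Bool => bif b then j true else j false) = j := by
      funext b
      cases b <;> rfl
    exact ⟨j true, j false, hj _, hj _, h.symm ▸ e⟩
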